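/- Let L ⊆ V^P be an isotropic subspace that does not split off a zero factor. Then Ā(L) = A(L)/Z(L) is a solvable compact Lie group. Consequently no universal set of gates on even one logical qubit can be realised transversally: for any identification of C(L,σ) with (ℂ²)^{⊗d}, the subgroup of SO(3) consisting of the one-qubit operators on a fixed logical qubit induced by elements of A(L) is a solvable (hence proper, since SO(3) is simple) closed subgroup of SO(3), and the same remains true for operators that admit only approximate transversal realisations. -/

import Mathlib

/- Common framework: binary stabilizer codes, local unitary/SO(3) automorphism groups. -/

noncomputable section
open scoped Matrix Real ComplexConjugate
open scoped Classical

namespace Stab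

/-- The one-qubit phase space `V = 𝔽₂ ⊕ 𝔽₂`, with first coordinate the `z`-component
and second coordinate the `x`-component. -/
abbrev V : Type := ZMod 2 × ZMod 2

/-- The symplectic form on `V`. -/
def omegaV (u v : V) : ZMod 2 := u.1 * v.2 + u.2 * v.1

/-- The phase space `V^P` over a set of qubits `P`. -/
abbrev QV (P : Type) := P → V

variable {P : Type} [Fintype P] [DecidableEq P]

/-- The direct-sum symplectic form on `V^P`. -/
def omega (u v : QV P) : ZMod 2 := ∑ p, omegaV (u p) (v p)

/-- A subspace `L ⊆ V^P` is isotropic if `ω` vanishes identically on `L × L`. -/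
def Isotropic (L : Submodule (ZMod 2) (QV P)) : Prop := ∀ u ∈ L, ∀ v ∈ L, omega u v = 0

/-- Support of a vector of `V^P`. -/
def supp (v : QV P) : Set P := {p | v p ≠ 0}

/-- The basis vector `z_p`. -/
def zvec (p : P) : QV P := Pi.single p ((1 : ZMod 2), (0 : ZMod 2))

/-- The basis vector `x_p`. -/
def xvec (p : P) : QV P := Pi.single p ((0 : ZMod 2), (1 : ZMod 2))

/-- Restriction (coordinate projection) of a vector to a subset `S ⊆ P`. -/
def restrTo (S : Set P) (v : QV P) : QV P := fun p => if p ∈ S then v p else 0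

/-- The coordinate subspace `V^S ⊆ V^P`. -/
def coordSub (S : Set P) : Submodule (ZMod 2) (QV P) where
  carrier := {v | ∀ p ∉ S, v p = 0}
  add_mem' := by intro a b ha hb p hp; simp [Pi.add_apply, ha p hp, hb p hp]
  zero_mem' := by intro p _; rfl
  smul_mem' := by intro c a ha p hp; simp [Pi.smul_apply, ha p hp]

/-- `L_S := L ∩ V^S`. -/
def LS (L : Submodule (ZMod 2) (QV P)) (S : Set P) : Submodule (ZMod 2) (QV P) :=
  L ⊓ coordSub S

/-- `L` splits as a direct factor on `S`, i.e. `L = L_S × L_{P∖S}`. -/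
def SplitsOn (L : Submodule (ZMod 2) (QV P)) (S : Set P) : Prop :=
  ∀ v ∈ L, restrTo S v ∈ L

/-- `L` splits off a zero factor: on some nonempty `S ⊆ P` all vectors of `L` vanish. -/
def HasZeroFactor (L : Submodule (ZMod 2) (QV P)) : Prop :=
  ∃ S : Set P, S.Nonempty ∧ ∀ v ∈ L, ∀ p ∈ S, v p = 0

/-- The qubit `p` is trivial: `L` splits off a one-dimensional factor on `{p}`. -/
def TrivialQubit (L : Submodule (ZMod 2) (QV P)) (p : P) : Prop :=
  SplitsOn L {p} ∧ ∃ v ∈ L, v ≠ 0 ∧ supp v ⊆ {p}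

/-- `L` splits off a trivial factor. -/
def HasTrivialFactor (L : Submodule (ZMod 2) (QV P)) : Prop :=
  ∃ p : P, TrivialQubit L p

/-- `L` splits off a Bell Lagrangian: an indecomposable Lagrangian direct factor on a
two-element set of qubits (all of whose nonzero vectors have full support `{p, q}`). -/
def HasBellFactor (L : Submodule (ZMod 2) (QV P)) : Prop :=
  ∃ p q : P, p ≠ q ∧ SplitsOn L {p, q} ∧
    ∃ v ∈ L, ∃ w ∈ L, v ≠ w ∧ supp v = {p, q} ∧ supp w = {p, q} ∧ supp (v + w) = {p, q}

/-- The factor `L_S` (for `S` in a partition) is indecomposable. -/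
def IndecompWithin (L : Submodule (ZMod 2) (QV P)) (S : Set P) : Prop :=
  ∀ T ⊆ S, SplitsOn L T → T = ∅ ∨ T = S

/-! ### The Hilbert space, Pauli operators and stabilizer codes -/

/-- The state space `ℋ^{⊗P} = (ℂ²)^{⊗P}`, realised concretely as functions on
computational basis labels. -/
abbrev HP (P : Type) := (P → Fin 2) → ℂ

/-- Operators on `ℋ^{⊗P}` as matrices. -/
abbrev MatP (P : Type) := Matrix (P → Fin 2) (P → Fin 2) ℂ

/-- The tensor (local) operator `⊗_{p} g_p` on `ℋ^{⊗P}`. -/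
def locOp (g : P → Matrix (Fin 2) (Fin 2) ℂ) : MatP P :=
  Matrix.of fun u w => ∏ p, g p (u p) (w p)

def sigmaX : Matrix (Fin 2) (Fin 2) ℂ := !![0, 1; 1, 0]
def sigmaY : Matrix (Fin 2) (Fin 2) ℂ := !![0, -Complex.I; Complex.I, 0]
def sigmaZ : Matrix (Fin 2) (Fin 2) ℂ := !![1, 0; 0, -1]

/-- The one-qubit Pauli operator `Z^a X^b` attached to `(a, b) ∈ V`. -/
def pauliMat (v : V) : Matrix (Fin 2) (Fin 2) ℂ := sigmaZ ^ (v.1 : ZMod 2).val * sigmaX ^ (v.2 : ZMod 2).val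

/-- The Pauli (Weyl) operator attached to `v ∈ V^P`. -/
def Wop (v : QV P) : MatP P := locOp fun p => pauliMat (v p)

/-- A group-homomorphic section `σ` over `L` of the projection from the Pauli group
`Ṽ^P` onto `V^P`: each value `σ(v)` is a unitary scalar multiple of the Pauli operator
`W(v)`, and `σ` is multiplicative on `L`. -/
structure PauliSection (L : Submodule (ZMod 2) (QV P)) where
  toFun : QV P → MatP P
  scalar : ∀ v : QV P, ∃ c : ℂ, toFun v = c • Wop v
  unitary : ∀ v : QV P, toFun v ∈ Matrix.unitaryGroup (P → Fin 2) ℂ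
  mul_of_mem : ∀ u ∈ L, ∀ v ∈ L, toFun (u + v) = toFun u * toFun v
  map_zero : toFun 0 = 1

/-- The stabilizer code `C(L, σ)`: the common fixed-point space of the stabilizer
group `σ(L)`. -/
def code (L : Submodule (ZMod 2) (QV P)) (σ : PauliSection L) : Submodule ℂ (HP P) where
  carrier := {ψ | ∀ v ∈ L, σ.toFun v *ᵥ ψ = ψ}
  add_mem' := by intro a b ha hb v hv; rw [Matrix.mulVec_add, ha v hv, hb v hv]
  zero_mem' := by intro v hv; simp
  smul_mem' := by intro c a ha v hv; rw [Matrix.mulVec_smul, ha v hv]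

/-- The standard section: `σ(v) = W(v)` on `L`. -/
def StandardOn (L : Submodule (ZMod 2) (QV P)) (σ : PauliSection L) : Prop :=
  ∀ v ∈ L, σ.toFun v = Wop v

/-! ### `SO(3)`, rotations, and the automorphism group of a code -/

/-- `3×3` real matrices. -/
abbrev Rot : Type := Matrix (Fin 3) (Fin 3) ℝ

/-- `SO(3)` as a set of `3×3` real matrices. -/
def SO3 : Set Rot := {A | A * Aᵀ = 1 ∧ A.det = 1}

/-- The ordered Pauli basis (x, y, z) of traceless Hermitian `2×2` matrices. -/
def pauliBasis : Fin 3 → Matrix (Fin 2) (Fin 2) ℂ := ![sigmaX, sigmaY, sigmaZ]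

/-- The image of a unitary `u ∈ U(2)` in `SO(3)` under the adjoint action on traceless
Hermitian operators (the identification `U(2)/S¹ = SO(3)`):
`u σ_j u† = Σ_i (adjRot u)_{ij} σ_i`. -/
def adjRot (u : Matrix (Fin 2) (Fin 2) ℂ) : Rot :=
  Matrix.of fun i j =>
    (1 / 2 : ℝ) * ((pauliBasis i * u * pauliBasis j * u.conjTranspose).trace).re

/-- Rotation about the `x`-axis by angle `θ`. -/
def rotX (θ : ℝ) : Rot := !![1, 0, 0; 0, Real.cos θ, -Real.sin θ; 0, Real.sin θ, Real.cos θ]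

/-- Rotation about the `y`-axis by angle `θ`. -/
def rotY (θ : ℝ) : Rot := !![Real.cos θ, 0, Real.sin θ; 0, 1, 0; -Real.sin θ, 0, Real.cos θ]

/-- Rotation about the `z`-axis by angle `θ`. -/
def rotZ (θ : ℝ) : Rot := !![Real.cos θ, -Real.sin θ, 0; Real.sin θ, Real.cos θ, 0; 0, 0, 1]

/-- The circle group `C_x ⊆ SO(3)` of rotations about the `x`-axis. -/
def Cx : Set Rot := Set.range rotX

/-- The circle group `C_y ⊆ SO(3)` of rotations about the `y`-axis. -/
def Cy : Set Rot := Set.range rotY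

/-- The circle group `C_z ⊆ SO(3)` of rotations about the `z`-axis. -/
def Cz : Set Rot := Set.range rotZ

/-- The octahedral group: the subgroup of `SO(3)` generated by the rotations by a right
angle about the three coordinate axes. -/
def octahedral : Set Rot :=
  (Submonoid.closure {rotX (π / 2), rotY (π / 2), rotZ (π / 2)} : Submonoid Rot)

/-- The infinite dihedral group `D_x ⊆ SO(3)`. -/
def Dx : Set Rot := (Submonoid.closure (Cx ∪ {rotZ π}) : Submonoid Rot)

/-- The infinite dihedral group `D_y ⊆ SO(3)`. -/
def Dy : Set Rot := (Submonoid.closure (Cy ∪ {rotZ π}) : Submonoid Rot)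

/-- The infinite dihedral group `D_z ⊆ SO(3)`. -/
def Dz : Set Rot := (Submonoid.closure (Cz ∪ {rotX π}) : Submonoid Rot)

/-- The automorphism group `A(L, σ) ⊆ SO(3)^P` of the stabilizer code `C(L, σ)`:
all families of rotations admitting a local unitary lift mapping the code into itself. -/
def autSet (L : Submodule (ZMod 2) (QV P)) (σ : PauliSection L) : Set (P → Rot) :=
  {g | ∃ u : P → Matrix (Fin 2) (Fin 2) ℂ,
        (∀ p, u p ∈ Matrix.unitaryGroup (Fin 2) ℂ) ∧
        (∀ p, adjRot (u p) = g p) ∧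
        ∀ ψ ∈ code L σ, locOp u *ᵥ ψ ∈ code L σ}

/-- The automorphism group `A(L, σ)_p` at the qubit `p`. -/
def autSetAt (L : Submodule (ZMod 2) (QV P)) (σ : PauliSection L) (p : P) : Set Rot :=
  (fun g => g p) '' autSet L σ

/-- The normal subgroup `Z(L, σ)` of automorphisms acting by a scalar on the code. -/
def zSet (L : Submodule (ZMod 2) (QV P)) (σ : PauliSection L) : Set (P → Rot) :=
  {g | ∃ u : P → Matrix (Fin 2) (Fin 2) ℂ,
        (∀ p, u p ∈ Matrix.unitaryGroup (Fin 2) ℂ) ∧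
        (∀ p, adjRot (u p) = g p) ∧
        ∃ c : ℂ, ∀ ψ ∈ code L σ, locOp u *ᵥ ψ = c • ψ}

/-! ### Restriction to subsets of qubits -/

/-- Restriction of a phase-space vector to the qubits of `S`. -/
def resQV (S : Set P) (v : QV P) : QV ↥S := fun s => v s

/-- Restriction as a linear map. -/
def resLin (S : Set P) : QV P →ₗ[ZMod 2] QV ↥S where
  toFun := resQV S
  map_add' := by intros; rfl
  map_smul' := by intros; rfl

/-- `L_S`, regarded as a subspace of `V^S`. -/
def LSsub (L : Submodule (ZMod 2) (QV P)) (S : Set P) : Submodule (ZMod 2) (QV ↥S) :=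
  Submodule.map (resLin S) (LS L S)

/-- The extension `M ⊗ 1` to `ℋ^{⊗P}` of an operator `M` on `ℋ^{⊗S}`. -/
def extendOp (S : Set P) (M : Matrix (↥S → Fin 2) (↥S → Fin 2) ℂ) : MatP P :=
  Matrix.of fun u w =>
    if ∀ p ∉ S, u p = w p then M (fun s => u s) (fun s => w s) else 0

/-- `σ'` is the restriction `σ|_{L_S}` of the section `σ` to `L_S`. -/
def RestrictedSection (L : Submodule (ZMod 2) (QV P)) (σ : PauliSection L) (S : Set P)
    (σ' : PauliSection (LSsub L S)) : Prop :=
  ∀ v ∈ LS L S, extendOp S (σ'.toFun (resQV S v)) = σ.toFun v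

/-! ### Contiguity, protected and gauge qubits, and normal forms -/

/-- Two qubits are contiguous if they are equal or `L` contains a vector supported
exactly on the pair. -/
def Contig (L : Submodule (ZMod 2) (QV P)) (p q : P) : Prop :=
  p = q ∨ ∃ v ∈ L, supp v = ({p, q} : Set P)

/-- The contiguity class of a qubit. -/
def contigClass (L : Submodule (ZMod 2) (QV P)) (p : P) : Set P := {q | Contig L p q}

/-- The qubit `p` is protected: the projection `L → V^{{p}}` is surjective. -/
def IsProtected (L : Submodule (ZMod 2) (QV P)) (p : P) : Prop :=
  ∀ w : V, ∃ v ∈ L, v p = w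

/-- The qubit `p` is of gauge type: the projection `L → V^{{p}}` has a line as image. -/
def IsGauge (L : Submodule (ZMod 2) (QV P)) (p : P) : Prop :=
  ¬ IsProtected L p ∧ ∃ v ∈ L, v p ≠ 0

/-- The subspace `⟨z_a + z_b : a ≠ b ∈ S⟩`. -/
def zspan (S : Set P) : Submodule (ZMod 2) (QV P) :=
  Submodule.span (ZMod 2) {w | ∃ a ∈ S, ∃ b ∈ S, a ≠ b ∧ w = zvec a + zvec b}

/-- The vector `Σ_{s ∈ S} x_s`. -/
def xsumOn (S : Set P) : QV P := S.indicator fun _ => ((0 : ZMod 2), (1 : ZMod 2))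

/-- Normal form of `L` (conclusion of the normalisation lemma): every contiguity class `S`
carries either `⟨z_a + z_b⟩` or `⟨z_a + z_b⟩ + ⟨Σ_{s∈S} x_s⟩`. -/
def NormalForm (L : Submodule (ZMod 2) (QV P)) : Prop :=
  ∀ p : P,
    LS L (contigClass L p) = zspan (contigClass L p) ∨
    LS L (contigClass L p) =
      zspan (contigClass L p) ⊔ Submodule.span (ZMod 2) {xsumOn (contigClass L p)}

/-- The pair `(L, σ)` is normalised. -/
def Normalised (L : Submodule (ZMod 2) (QV P)) (σ : PauliSection L) : Prop :=
  NormalForm L ∧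
  (∀ p : P, IsGauge L p → contigClass L p = {p} → ∀ v ∈ L, (v p).2 = 0) ∧
  (∀ p : P, IsProtected L p → contigClass L p = {p} →
    connectedComponentIn (autSetAt L σ p) 1 ⊆ Cz) ∧
  (∀ p : P, IsProtected L p → contigClass L p ≠ {p} →
    LS L (contigClass L p) = zspan (contigClass L p) →
    ∃ v ∈ L, ∀ s ∈ contigClass L p, v s = ((0 : ZMod 2), (1 : ZMod 2))) ∧
  (∀ p q : P, p ≠ q → Contig L p q →
    σ.toFun (zvec p + zvec q) = Wop (zvec p + zvec q))

/-- A local symplectic family of automorphisms of `V`. -/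
def IsLocalSymp (f : P → (V ≃ₗ[ZMod 2] V)) : Prop :=
  ∀ (p : P) (u v : V), omegaV (f p u) (f p v) = omegaV u v

/-- The image of `L` under a local (symplectic) transformation. -/
def mapL (L : Submodule (ZMod 2) (QV P)) (f : P → (V ≃ₗ[ZMod 2] V)) :
    Submodule (ZMod 2) (QV P) :=
  Submodule.map (LinearEquiv.piCongrRight f : QV P ≃ₗ[ZMod 2] QV P).toLinearMap L

/-! ### Abstract group structures carried by subsets of a monoid -/

/-- The set `s` carries the structure of a solvable group. -/
structure SolvableGroupStructure (M : Type) [Monoid M] (s : Set M) where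
  G : Type
  [grp : Group G]
  solv : IsSolvable G
  f : G → M
  inj : Function.Injective f
  map_mul : ∀ a b : G, f (a * b) = f a * f b
  range_eq : Set.range f = s

/-- The quotient of the group (carried by) `A` by the normal subgroup (carried by) `Z`
is a compact solvable topological (Lie) group. -/
structure CompactSolvableQuotientStructure (M : Type) [Monoid M] [TopologicalSpace M]
    (A Z : Set M) where
  G : Type
  [grp : Group G]
  [top : TopologicalSpace G]
  [tgrp : IsTopologicalGroup G]
  cpt : CompactSpace G
  solv : IsSolvable G
  φ : M → G
  cont : ContinuousOn φ A
  map_mul' : ∀ a ∈ A, ∀ b ∈ A, φ (a * b) = φ a * φ b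
  surj : ∀ y : G, ∃ a ∈ A, φ a = y
  ker : ∀ a ∈ A, (φ a = 1 ↔ a ∈ Z)

/-! ### Logical qubits and transversally realisable gates -/

/-- The standard hermitian inner product on a finite-dimensional function space. -/
def innerF {ι : Type} [Fintype ι] (ψ φ : ι → ℂ) : ℂ := ∑ i, (starRingEnd ℂ) (ψ i) * φ i

/-- `e` is a unitary identification of the code space with a space of logical qubits. -/
def IsUnitaryEquiv (L : Submodule (ZMod 2) (QV P)) (σ : PauliSection L) {d : ℕ}
    (e : ↥(code L σ) ≃ₗ[ℂ] HP (Fin d)) : Prop :=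
  ∀ ψ φ : ↥(code L σ),
    innerF (e ψ) (e φ) = innerF (ψ : HP P) (φ : HP P)

/-- The operator acting as `w` on the logical qubit `k` and trivially elsewhere. -/
def oneQubitOp (d : ℕ) (k : Fin d) (w : Matrix (Fin 2) (Fin 2) ℂ) : MatP (Fin d) :=
  locOp fun j => if j = k then w else 1

/-- The set of rotations in `SO(3)` induced, via the identification `e`, on a fixed
logical qubit `k` by (exactly realised) transversal gates, i.e. by elements of `A(L, σ)`. -/
def logicalSet (L : Submodule (ZMod 2) (QV P)) (σ : PauliSection L) {d : ℕ}
    (e : ↥(code L σ) ≃ₗ[ℂ] HP (Fin d)) (k : Fin d) : Set Rot :=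
  {A | ∃ w ∈ Matrix.unitaryGroup (Fin 2) ℂ, adjRot w = A ∧
        ∃ u : P → Matrix (Fin 2) (Fin 2) ℂ,
          (∀ p, u p ∈ Matrix.unitaryGroup (Fin 2) ℂ) ∧
          ∀ φ : HP (Fin d),
            locOp u *ᵥ ((e.symm φ : HP P)) = ((e.symm (oneQubitOp d k w *ᵥ φ) : HP P))}

/-! ### Reed–Muller codes -/

/-- The qubit set `P = 𝔽₂^m ∖ {0}`. -/
abbrev RMQubits (m : ℕ) := {s : Fin m → ZMod 2 // s ≠ 0}

/-- Polynomial functions on `𝔽₂^m` of degree at most `r` with zero constant term. -/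
def RMspan (r m : ℕ) : Submodule (ZMod 2) ((Fin m → ZMod 2) → ZMod 2) :=
  Submodule.span (ZMod 2)
    {f | ∃ I : Finset (Fin m), I.Nonempty ∧ I.card ≤ r ∧ f = fun s => ∏ i ∈ I, s i}

/-- The shortened Reed–Muller code `R_*(r, m) ⊆ 𝔽₂^P`. -/
def RMstar (r m : ℕ) : Submodule (ZMod 2) (RMQubits m → ZMod 2) :=
  Submodule.map (LinearMap.funLeft (ZMod 2) (ZMod 2) Subtype.val) (RMspan r m)

/-- The `z`-part of a phase-space vector. -/
def zPart {P : Type} : QV P →ₗ[ZMod 2] (P → ZMod 2) where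
  toFun v := fun p => (v p).1
  map_add' := by intros; rfl
  map_smul' := by intros; rfl

/-- The `x`-part of a phase-space vector. -/
def xPart {P : Type} : QV P →ₗ[ZMod 2] (P → ZMod 2) where
  toFun v := fun p => (v p).2
  map_add' := by intros; rfl
  map_smul' := by intros; rfl

/-- The Calderbank–Shor–Steane isotropic subspace built from the shortened Reed–Muller
codes `R_*(m−2, m)` (in the `z`-coordinates) and `R_*(1, m)` (in the `x`-coordinates). -/
def cssL (m : ℕ) : Submodule (ZMod 2) (QV (RMQubits m)) :=
  Submodule.comap zPart (RMstar (m - 2) m) ⊓ Submodule.comap xPart (RMstar 1 m)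

/-- The stabilizer state `|0⟩_S ⊗ |0⟩_T + |0⟩_S ⊗ |1⟩_T + |1⟩_S ⊗ |0⟩_T − |1⟩_S ⊗ |1⟩_T`
(with `T = Sᶜ`), written in the computational basis. -/
def bellLike (S : Set P) (p q : P) : HP P := fun u =>
  if (∀ a ∈ S, u a = u p) ∧ (∀ a ∈ Sᶜ, u a = u q) then
    ((-1 : ℂ)) ^ ((u p : Fin 2).val * (u q : Fin 2).val) else 0


set_option linter.unusedSectionVars false

/-! ### Local operators -/

theorem locOp_mul (a b : P → Matrix (Fin 2) (Fin 2) ℂ) :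
    locOp (fun p => a p * b p) = locOp a * locOp b := by
  ext u w
  simp only [locOp, Matrix.mul_apply, Matrix.of_apply]
  rw [Finset.prod_univ_sum, Fintype.piFinset_univ]
  simp only [Finset.prod_mul_distrib]

theorem locOp_one : locOp (fun _ : P => (1 : Matrix (Fin 2) (Fin 2) ℂ)) = 1 := by
  ext u w
  simp only [locOp, Matrix.of_apply, Matrix.one_apply]
  by_cases h : u = w
  · simp [h]
  · rw [if_neg h]
    obtain ⟨p, hp⟩ := Function.ne_iff.mp h
    exact Finset.prod_eq_zero (Finset.mem_univ p) (if_neg hp)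

theorem locOp_conjTranspose (a : P → Matrix (Fin 2) (Fin 2) ℂ) :
    (locOp a)ᴴ = locOp fun p => (a p)ᴴ := by
  ext u w
  simp [locOp, Matrix.conjTranspose_apply]

theorem locOp_trace (a : P → Matrix (Fin 2) (Fin 2) ℂ) :
    (locOp a).trace = ∏ p, (a p).trace := by
  simp only [locOp, Matrix.trace, Matrix.diag_apply, Matrix.of_apply]
  rw [Finset.prod_univ_sum, Fintype.piFinset_univ]

theorem locOp_smul (c : P → ℂ) (a : P → Matrix (Fin 2) (Fin 2) ℂ) :
    (locOp fun p => c p • a p) = (∏ p, c p) • locOp a := by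
  ext u w
  simp [locOp, Finset.prod_mul_distrib]

theorem locOp_sum {ι : Type} [Fintype ι] (c : P → ι → ℂ)
    (a : P → ι → Matrix (Fin 2) (Fin 2) ℂ) :
    (locOp fun p => ∑ i, c p i • a p i) =
      ∑ w : P → ι, (∏ p, c p (w p)) • locOp fun p => a p (w p) := by
  ext u v
  simp only [locOp, Matrix.of_apply, Matrix.sum_apply, Matrix.smul_apply, smul_eq_mul]
  rw [Finset.prod_univ_sum, Fintype.piFinset_univ]
  simp only [Finset.prod_mul_distrib]

/-! ### One-qubit Pauli operators -/

/-- The coefficient of a one-qubit operator at the Pauli operator `pauliMat b`. -/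
def pauliCoef (m : Matrix (Fin 2) (Fin 2) ℂ) (b : V) : ℂ :=
  (1 / 2 : ℂ) * ((pauliMat b)ᴴ * m).trace

theorem univ_V : (Finset.univ : Finset V) = {(0, 0), (0, 1), (1, 0), (1, 1)} := by decide

theorem sum_V {M : Type*} [AddCommMonoid M] (f : V → M) :
    ∑ v, f v = f (0, 0) + f (0, 1) + f (1, 0) + f (1, 1) := by
  rw [univ_V, Finset.sum_insert (by decide), Finset.sum_insert (by decide),
    Finset.sum_insert (by decide), Finset.sum_singleton]
  simp only [add_assoc]

theorem forall_V {p : V → Prop} :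
    (∀ v, p v) ↔ p (0, 0) ∧ p (0, 1) ∧ p (1, 0) ∧ p (1, 1) := by
  constructor
  · intro h; exact ⟨h _, h _, h _, h _⟩
  · rintro ⟨h0, h1, h2, h3⟩ ⟨a, b⟩
    fin_cases a <;> fin_cases b <;> assumption

theorem pauliMat_zz : pauliMat (0, 0) = 1 := by
  simp [pauliMat]

theorem pauliMat_zero : pauliMat 0 = 1 := pauliMat_zz

theorem pauliMat_zo : pauliMat (0, 1) = !![0, 1; 1, 0] := by
  simp [pauliMat, sigmaX, ZMod.val_one]

theorem pauliMat_oz : pauliMat (1, 0) = !![1, 0; 0, -1] := by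
  simp [pauliMat, sigmaZ, ZMod.val_one]

theorem pauliMat_oo : pauliMat (1, 1) = !![0, 1; -1, 0] := by
  simp [pauliMat, sigmaZ, sigmaX, ZMod.val_one]

theorem sum_pauliCoef (m : Matrix (Fin 2) (Fin 2) ℂ) :
    ∑ b, pauliCoef m b • pauliMat b = m := by
  rw [sum_V]
  ext i j
  fin_cases i <;> fin_cases j <;>
    simp [pauliCoef, pauliMat_zz, pauliMat_zo, pauliMat_oz, pauliMat_oo, Matrix.trace_fin_two,
      Matrix.mul_apply, Fin.sum_univ_two, Matrix.conjTranspose_apply, Matrix.add_apply] <;> ring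

theorem pauliCoef_pauliMat (a b : V) : pauliCoef (pauliMat a) b = if b = a then 1 else 0 := by
  revert a b
  simp only [forall_V]
  refine ⟨⟨?_, ?_, ?_, ?_⟩, ⟨?_, ?_, ?_, ?_⟩, ⟨?_, ?_, ?_, ?_⟩, ⟨?_, ?_, ?_, ?_⟩⟩ <;>
    simp [pauliCoef, pauliMat_zz, pauliMat_zo, pauliMat_oz, pauliMat_oo, Matrix.trace_fin_two,
      Matrix.mul_apply, Fin.sum_univ_two, Matrix.conjTranspose_apply] <;> norm_num

/-- The character of `𝔽₂` with values `±1`. -/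
def chi (x : ZMod 2) : ℂ := if x = 0 then 1 else -1

theorem chi_add (x y : ZMod 2) : chi (x + y) = chi x * chi y := by
  have h : ∀ x : ZMod 2, x = 0 ∨ x = 1 := by decide
  have h11 : (1 + 1 : ZMod 2) = 0 := by decide
  rcases h x with rfl | rfl <;> rcases h y with rfl | rfl <;> simp [chi, h11]

theorem chi_sum (f : P → ZMod 2) : chi (∑ p, f p) = ∏ p, chi (f p) := by
  induction (Finset.univ : Finset P) using Finset.induction_on with
  | empty => simp [chi]
  | insert a s ha ih => rw [Finset.sum_insert ha, Finset.prod_insert ha, chi_add, ih]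

theorem pauliMat_mul_comm (a b : V) :
    pauliMat a * pauliMat b = chi (omegaV a b) • (pauliMat b * pauliMat a) := by
  have h11 : (1 + 1 : ZMod 2) = 0 := by decide
  revert a b
  simp only [forall_V]
  refine ⟨⟨?_, ?_, ?_, ?_⟩, ⟨?_, ?_, ?_, ?_⟩, ⟨?_, ?_, ?_, ?_⟩, ⟨?_, ?_, ?_, ?_⟩⟩ <;>
    simp [chi, omegaV, h11, pauliMat_zz, pauliMat_zo, pauliMat_oz, pauliMat_oo]

theorem pauliMat_mul_conjTranspose (a : V) : pauliMat a * (pauliMat a)ᴴ = 1 := by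
  revert a
  simp only [forall_V]
  refine ⟨?_, ?_, ?_, ?_⟩ <;> ext i j <;> fin_cases i <;> fin_cases j <;>
    simp [pauliMat_zz, pauliMat_zo, pauliMat_oz, pauliMat_oo, Matrix.mul_apply,
      Fin.sum_univ_two, Matrix.conjTranspose_apply]

theorem pauliMat_ne_zero (a : V) : pauliMat a ≠ 0 := by
  intro h
  have := pauliMat_mul_conjTranspose a
  simp [h] at this

/-- An operator commuting with all Pauli operators is a scalar. -/
theorem eq_smul_one_of_commute {m : Matrix (Fin 2) (Fin 2) ℂ}
    (h : ∀ a, m * pauliMat a = pauliMat a * m) : m = m 0 0 • 1 := by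
  have hx := h (0, 1)
  have hz := h (1, 0)
  rw [pauliMat_zo] at hx
  rw [pauliMat_oz] at hz
  have e1 := congrFun (congrFun hx 0) 1
  have e2 := congrFun (congrFun hz 0) 1
  have e3 := congrFun (congrFun hz 1) 0
  simp [Matrix.mul_apply, Fin.sum_univ_two] at e1 e2 e3
  have e2' : m 0 1 = 0 := by linear_combination (-1 / 2) * e2
  have e3' : m 1 0 = 0 := by linear_combination (1 / 2) * e3
  ext i j
  fin_cases i <;> fin_cases j <;> simp [e1, e2', e3']

/-- Two operators commuting with the same nontrivial Pauli operator commute. -/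
theorem commute_of_commute_pauliMat {a : V} (ha : a ≠ 0) {m n : Matrix (Fin 2) (Fin 2) ℂ}
    (hm : m * pauliMat a = pauliMat a * m) (hn : n * pauliMat a = pauliMat a * n) :
    m * n = n * m := by
  revert a
  simp only [forall_V, pauliMat_zz, pauliMat_zo, pauliMat_oz, pauliMat_oo]
  refine ⟨fun h => absurd rfl h, fun _ => ?_, fun _ => ?_, fun _ => ?_⟩ <;> intro hm hn <;>
  · have m1 := congrFun (congrFun hm 0) 0
    have m2 := congrFun (congrFun hm 0) 1
    have m3 := congrFun (congrFun hm 1) 0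
    have n1 := congrFun (congrFun hn 0) 0
    have n2 := congrFun (congrFun hn 0) 1
    have n3 := congrFun (congrFun hn 1) 0
    simp [Matrix.mul_apply, Fin.sum_univ_two] at m1 m2 m3 n1 n2 n3
    ext i j
    fin_cases i <;> fin_cases j <;> simp [Matrix.mul_apply, Fin.sum_univ_two] <;> grind

/-! ### The adjoint action in the Pauli basis -/

/-- The matrix of the conjugation by `u` in the basis of Pauli operators. -/
def conjCoef (u : Matrix (Fin 2) (Fin 2) ℂ) (b a : V) : ℂ := pauliCoef (u * pauliMat a * uᴴ) b

theorem conj_pauliMat (u : Matrix (Fin 2) (Fin 2) ℂ) (a : V) :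
    u * pauliMat a * uᴴ = ∑ b, conjCoef u b a • pauliMat b := (sum_pauliCoef _).symm

theorem conjCoef_one (b a : V) : conjCoef 1 b a = if b = a then 1 else 0 := by
  simp [conjCoef, pauliCoef_pauliMat]

theorem conjCoef_zero_right {u : Matrix (Fin 2) (Fin 2) ℂ} (hu : u * uᴴ = 1) (b : V) :
    conjCoef u b 0 = if b = 0 then 1 else 0 := by
  rw [conjCoef, pauliMat_zero, mul_one, hu, ← pauliMat_zero, pauliCoef_pauliMat]

theorem conjCoef_zero_left {u : Matrix (Fin 2) (Fin 2) ℂ} (hu : u * uᴴ = 1) (a : V) :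
    conjCoef u 0 a = if a = 0 then 1 else 0 := by
  have hu' : uᴴ * u = 1 := mul_eq_one_comm.mp hu
  have := pauliCoef_pauliMat a 0
  rw [pauliCoef, pauliMat_zero, Matrix.conjTranspose_one, one_mul] at this
  rw [conjCoef, pauliCoef, pauliMat_zero, Matrix.conjTranspose_one, one_mul,
    Matrix.trace_mul_comm, ← mul_assoc, hu', one_mul, this]
  simp only [eq_comm]

theorem exists_conjCoef_ne_zero {u : Matrix (Fin 2) (Fin 2) ℂ} (hu : u * uᴴ = 1) (a : V) :
    ∃ b, conjCoef u b a ≠ 0 := by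
  by_contra! h
  have h1 := conj_pauliMat u a
  simp only [h, zero_smul, Finset.sum_const_zero] at h1
  have hu' : uᴴ * u = 1 := mul_eq_one_comm.mp hu
  apply pauliMat_ne_zero a
  calc pauliMat a = (uᴴ * u) * pauliMat a * (uᴴ * u) := by rw [hu', one_mul, mul_one]
    _ = uᴴ * (u * pauliMat a * uᴴ) * u := by simp only [mul_assoc]
    _ = 0 := by rw [h1]; simp

/-! ### Pauli operators on several qubits -/

theorem locOp_expand (m : P → Matrix (Fin 2) (Fin 2) ℂ) :
    locOp m = ∑ w : QV P, (∏ p, pauliCoef (m p) (w p)) • Wop w := by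
  have h := locOp_sum (fun p b => pauliCoef (m p) b) (fun (_ : P) b => pauliMat b)
  simp only [sum_pauliCoef] at h
  exact h

theorem locOp_conj_Wop (u : P → Matrix (Fin 2) (Fin 2) ℂ) (v : QV P) :
    locOp u * Wop v * (locOp u)ᴴ = ∑ w : QV P, (∏ p, conjCoef (u p) (w p) (v p)) • Wop w := by
  rw [Wop, locOp_conjTranspose, ← locOp_mul, ← locOp_mul, locOp_expand]
  rfl

theorem trace_Wop_mul (w v : QV P) :
    ((Wop w)ᴴ * Wop v).trace = if w = v then 2 ^ Fintype.card P else 0 := by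
  have h : ∀ b a : V, ((pauliMat b)ᴴ * pauliMat a).trace = if b = a then 2 else 0 := by
    intro b a
    have := pauliCoef_pauliMat a b
    rw [pauliCoef] at this
    split_ifs at this ⊢ <;> linear_combination 2 * this
  rw [Wop, Wop, locOp_conjTranspose, ← locOp_mul, locOp_trace]
  simp only [h]
  by_cases hwv : w = v
  · simp [hwv]
  · rw [if_neg hwv]
    obtain ⟨p, hp⟩ := Function.ne_iff.mp hwv
    exact Finset.prod_eq_zero (Finset.mem_univ p) (if_neg hp)

/-- The Pauli operators are linearly independent. -/
theorem Wop_coef_unique {f g : QV P → ℂ} (h : ∑ w, f w • Wop w = ∑ w, g w • Wop w) :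
    f = g := by
  funext w
  have h2 := congrArg (fun M => ((Wop w)ᴴ * M).trace) h
  simp only [Matrix.mul_sum, Matrix.trace_sum, Matrix.mul_smul, Matrix.trace_smul,
    trace_Wop_mul, smul_eq_mul, mul_ite, mul_zero, Finset.sum_ite_eq, Finset.mem_univ,
    if_true] at h2
  exact mul_right_cancel₀ (pow_ne_zero _ two_ne_zero) h2

theorem Wop_mul_comm (v w : QV P) : Wop v * Wop w = chi (omega v w) • (Wop w * Wop v) := by
  rw [Wop, Wop, ← locOp_mul, ← locOp_mul, omega, chi_sum, ← locOp_smul]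
  simp only [pauliMat_mul_comm (v _) (w _)]

/-! ### The group of transversal unitaries preserving a code -/

/-- The unitary group `U(2)`. -/
abbrev U2 : Type := Matrix.unitaryGroup (Fin 2) ℂ

/-- The local unitary operator attached to a family of elements of `U(2)`. -/
def opOf (u : P → U2) : MatP P := locOp fun p => (u p : Matrix (Fin 2) (Fin 2) ℂ)

theorem opOf_mul (u v : P → U2) : opOf (u * v) = opOf u * opOf v :=
  locOp_mul _ _

theorem opOf_one : opOf (1 : P → U2) = 1 := locOp_one

theorem opOf_inv (u : P → U2) : opOf u⁻¹ = (opOf u)ᴴ := by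
  rw [opOf, opOf, locOp_conjTranspose]
  rfl

theorem opOf_inv_mul (u : P → U2) : opOf u⁻¹ * opOf u = 1 := by
  rw [← opOf_mul, inv_mul_cancel, opOf_one]

theorem opOf_mul_inv (u : P → U2) : opOf u * opOf u⁻¹ = 1 := by
  rw [← opOf_mul, mul_inv_cancel, opOf_one]

theorem opOf_inv_mulVec_mem {C : Submodule ℂ (HP P)} {u : P → U2}
    (hu : ∀ ψ ∈ C, opOf u *ᵥ ψ ∈ C) : ∀ ψ ∈ C, opOf u⁻¹ *ᵥ ψ ∈ C := by
  intro ψ hψ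
  let f : C →ₗ[ℂ] C := (Matrix.mulVecLin (opOf u)).restrict hu
  have hf : Function.Injective f := by
    intro a b hab
    have h := congrArg (fun x : C => opOf u⁻¹ *ᵥ (x : HP P)) hab
    have key : ∀ x : C, opOf u⁻¹ *ᵥ (f x : HP P) = x := by
      intro x
      change opOf u⁻¹ *ᵥ (opOf u *ᵥ (x : HP P)) = x
      rw [Matrix.mulVec_mulVec, opOf_inv_mul, Matrix.one_mulVec]
    simp only [key] at h
    exact Subtype.ext h
  obtain ⟨φ, hφ⟩ := LinearMap.surjective_of_injective hf ⟨ψ, hψ⟩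
  have h : opOf u *ᵥ (φ : HP P) = ψ := congrArg Subtype.val hφ
  rw [← h, Matrix.mulVec_mulVec, opOf_inv_mul, Matrix.one_mulVec]
  exact φ.2

/-- The group of families of elements of `U(2)` preserving the code. -/
def transversalGroup (L : Submodule (ZMod 2) (QV P)) (σ : PauliSection L) :
    Subgroup (P → U2) where
  carrier := {u | ∀ ψ ∈ code L σ, opOf u *ᵥ ψ ∈ code L σ}
  mul_mem' := by
    intro a b ha hb ψ hψ
    rw [opOf_mul, ← Matrix.mulVec_mulVec]
    exact ha _ (hb _ hψ)
  one_mem' := by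
    intro ψ hψ
    rwa [opOf_one, Matrix.one_mulVec]
  inv_mem' := opOf_inv_mulVec_mem

/-- The subgroup of families of elements of `U(2)` acting by a scalar on the code. -/
def scalarGroup (L : Submodule (ZMod 2) (QV P)) (σ : PauliSection L) :
    Subgroup (P → U2) where
  carrier := {u | ∃ c : ℂ, ∀ ψ ∈ code L σ, opOf u *ᵥ ψ = c • ψ}
  mul_mem' := by
    rintro a b ⟨c, hc⟩ ⟨d, hd⟩
    refine ⟨d * c, fun ψ hψ => ?_⟩
    rw [opOf_mul, ← Matrix.mulVec_mulVec, hd ψ hψ, Matrix.mulVec_smul, hc ψ hψ, smul_smul]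
  one_mem' := ⟨1, fun ψ _ => by rw [opOf_one, Matrix.one_mulVec, one_smul]⟩
  inv_mem' := by
    rintro u ⟨c, hc⟩
    refine ⟨c⁻¹, fun ψ hψ => ?_⟩
    have h : ψ = c • (opOf u⁻¹ *ᵥ ψ) := by
      rw [← Matrix.mulVec_smul, ← hc ψ hψ, Matrix.mulVec_mulVec, opOf_inv_mul, Matrix.one_mulVec]
    by_cases hc0 : c = 0
    · have h0 : ψ = 0 := by rw [h, hc0, zero_smul]
      simp [h0]
    · nth_rewrite 2 [h]
      rw [smul_smul, inv_mul_cancel₀ hc0, one_smul]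

/-! ### The sum of the stabilizer group -/

/-- The scalar by which a section differs from the Pauli operator, extended by zero
outside `M`. -/
def secCoef {L : Submodule (ZMod 2) (QV P)} (σ : PauliSection L)
    (M : Submodule (ZMod 2) (QV P)) (v : QV P) : ℂ :=
  if v ∈ M then (σ.scalar v).choose else 0

/-- The sum of the stabilizers in `M`. -/
def stabSum {L : Submodule (ZMod 2) (QV P)} (σ : PauliSection L)
    (M : Submodule (ZMod 2) (QV P)) : MatP P :=
  ∑ v, secCoef σ M v • Wop v

section StabSum

variable {L : Submodule (ZMod 2) (QV P)} (σ : PauliSection L) {M : Submodule (ZMod 2) (QV P)}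

theorem section_ne_zero (v : QV P) : σ.toFun v ≠ 0 := by
  intro h
  have h1 := σ.unitary v
  rw [h, Matrix.mem_unitaryGroup_iff, zero_mul] at h1
  exact zero_ne_one h1

theorem section_eq {v : QV P} (hv : v ∈ M) : σ.toFun v = secCoef σ M v • Wop v := by
  rw [secCoef, if_pos hv]
  exact (σ.scalar v).choose_spec

theorem secCoef_ne_zero_iff {v : QV P} : secCoef σ M v ≠ 0 ↔ v ∈ M := by
  constructor
  · intro h
    by_contra hv
    exact h (if_neg hv)
  · intro hv h
    have := section_eq σ hv
    rw [h, zero_smul] at this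
    exact section_ne_zero σ v this

theorem secCoef_eq_zero {v : QV P} (hv : v ∉ M) : secCoef σ M v = 0 := if_neg hv

theorem stabSum_eq_sum : stabSum σ M = ∑ v : M, σ.toFun v := by
  rw [stabSum, ← Finset.sum_subtype (Finset.univ.filter (· ∈ M)) (by simp) σ.toFun,
    Finset.sum_filter]
  refine Finset.sum_congr rfl fun v _ => ?_
  split_ifs with h
  · exact (section_eq σ h).symm
  · rw [secCoef_eq_zero σ h, zero_smul]

theorem section_mul_stabSum (hM : M ≤ L) {v : QV P} (hv : v ∈ M) :
    σ.toFun v * stabSum σ M = stabSum σ M := by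
  rw [stabSum_eq_sum, Finset.mul_sum]
  refine Fintype.sum_equiv (Equiv.addLeft (⟨v, hv⟩ : M)) _ _ fun w => ?_
  exact (σ.mul_of_mem v (hM hv) w (hM w.2)).symm

theorem stabSum_mul_section (hM : M ≤ L) {v : QV P} (hv : v ∈ M) :
    stabSum σ M * σ.toFun v = stabSum σ M := by
  rw [stabSum_eq_sum, Finset.sum_mul]
  refine Fintype.sum_equiv (Equiv.addRight (⟨v, hv⟩ : M)) _ _ fun w => ?_
  exact (σ.mul_of_mem w (hM w.2) v (hM hv)).symm

theorem stabSum_mulVec (hM : M ≤ L) {ψ : HP P} (hψ : ψ ∈ code L σ) :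
    stabSum σ M *ᵥ ψ = (Fintype.card M : ℂ) • ψ := by
  have h : ∀ v : M, σ.toFun v *ᵥ ψ = ψ := fun v => hψ v (hM v.2)
  rw [stabSum_eq_sum, Matrix.sum_mulVec]
  simp [h, ← Nat.cast_smul_eq_nsmul ℂ]

theorem stabSum_mulVec_mem (ψ : HP P) : stabSum σ L *ᵥ ψ ∈ code L σ := by
  intro v hv
  rw [Matrix.mulVec_mulVec, section_mul_stabSum σ le_rfl hv]

theorem section_conjTranspose {v : QV P} (hv : v ∈ L) : (σ.toFun v)ᴴ = σ.toFun v := by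
  have h1 : (σ.toFun v)ᴴ * σ.toFun v = 1 := Matrix.mem_unitaryGroup_iff'.mp (σ.unitary v)
  have h2 : σ.toFun v * σ.toFun v = 1 := by
    rw [← σ.mul_of_mem v hv v hv, ZModModule.add_self, σ.map_zero]
  exact left_inv_eq_right_inv h1 h2

theorem stabSum_conjTranspose (hM : M ≤ L) : (stabSum σ M)ᴴ = stabSum σ M := by
  rw [stabSum_eq_sum, Matrix.conjTranspose_sum]
  exact Finset.sum_congr rfl fun v _ => section_conjTranspose σ (hM v.2)

theorem stabSum_mul_opOf_mul {u : P → U2} (hu : u ∈ transversalGroup L σ) :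
    stabSum σ L * opOf u * stabSum σ L = (Fintype.card L : ℂ) • (opOf u * stabSum σ L) := by
  refine Matrix.toLin'.injective (LinearMap.ext fun ψ => ?_)
  simp only [Matrix.toLin'_apply, Matrix.smul_mulVec]
  rw [← Matrix.mulVec_mulVec, ← Matrix.mulVec_mulVec, ← Matrix.mulVec_mulVec]
  exact stabSum_mulVec σ le_rfl (hu _ (stabSum_mulVec_mem σ ψ))

/-- Transversal operators preserving the code commute with the sum of the stabilizers. -/
theorem opOf_mul_stabSum {u : P → U2} (hu : u ∈ transversalGroup L σ) :
    opOf u * stabSum σ L = stabSum σ L * opOf u := by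
  have h1 := stabSum_mul_opOf_mul σ hu
  have h2 := congrArg Matrix.conjTranspose
    (stabSum_mul_opOf_mul σ ((transversalGroup L σ).inv_mem hu))
  simp only [Matrix.conjTranspose_mul, Matrix.conjTranspose_smul, stabSum_conjTranspose σ le_rfl,
    opOf_inv, Matrix.conjTranspose_conjTranspose, star_natCast, ← mul_assoc] at h2
  have hc : (Fintype.card L : ℂ) ≠ 0 := Nat.cast_ne_zero.mpr Fintype.card_ne_zero
  exact smul_right_injective _ hc (h1.symm.trans h2)

end StabSum

/-! ### Invariance of the coefficients -/

/-- The matrix of the conjugation by a local unitary in the basis of Pauli operators. -/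
def prodCoef (u : P → U2) (w v : QV P) : ℂ := ∏ p, conjCoef (u p) (w p) (v p)

theorem U2_mul_conjTranspose (u : U2) :
    (u : Matrix (Fin 2) (Fin 2) ℂ) * (u : Matrix (Fin 2) (Fin 2) ℂ)ᴴ = 1 :=
  Matrix.mem_unitaryGroup_iff.mp u.2

theorem U2_conjTranspose_mul (u : U2) :
    (u : Matrix (Fin 2) (Fin 2) ℂ)ᴴ * (u : Matrix (Fin 2) (Fin 2) ℂ) = 1 :=
  Matrix.mem_unitaryGroup_iff'.mp u.2

theorem prodCoef_ne_zero {u : P → U2} {w v : QV P} (h : prodCoef u w v ≠ 0) :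
    (∀ p, w p = 0 ↔ v p = 0) ∧ ∀ p, u p = 1 → w p = v p := by
  have h' := fun p => Finset.prod_ne_zero_iff.mp h p (Finset.mem_univ p)
  refine ⟨fun p => ⟨fun hw => ?_, fun hv => ?_⟩, fun p hp => ?_⟩
  · by_contra hv
    apply h' p
    rw [hw, conjCoef_zero_left (U2_mul_conjTranspose _), if_neg hv]
  · by_contra hw
    apply h' p
    rw [hv, conjCoef_zero_right (U2_mul_conjTranspose _), if_neg hw]
  · by_contra hwv
    apply h' p
    rw [hp]
    exact (conjCoef_one _ _).trans (if_neg hwv)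

theorem opOf_conj_sum (u : P → U2) (t : QV P → ℂ) :
    opOf u * (∑ v, t v • Wop v) * (opOf u)ᴴ =
      ∑ w, (∑ v, t v * prodCoef u w v) • Wop w := by
  rw [Finset.mul_sum, Finset.sum_mul]
  simp only [Matrix.mul_smul, Matrix.smul_mul, Finset.sum_smul]
  rw [Finset.sum_comm]
  refine Finset.sum_congr rfl fun v _ => ?_
  rw [opOf, locOp_conj_Wop, Finset.smul_sum]
  simp only [smul_smul]
  rfl

/-- The restriction of a family to the qubits in `T`. -/
def onQubits (T : Set P) (u : P → U2) : P → U2 := fun p => if p ∈ T then u p else 1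

theorem onQubits_mul_compl (T : Set P) (u : P → U2) :
    onQubits Tᶜ u * onQubits T u = u := by
  funext p
  by_cases h : p ∈ T <;> simp [onQubits, h]

/-- Conjugating the stabilizer sum by a code-preserving family on the qubits in `T` has the
same effect as conjugating by the inverse family on the other qubits. -/
theorem sum_prodCoef_onQubits {L : Submodule (ZMod 2) (QV P)} (σ : PauliSection L)
    {u : P → U2} (hu : u ∈ transversalGroup L σ) (T : Set P) (w : QV P) :
    ∑ v, secCoef σ L v * prodCoef (onQubits T u) w v =
      ∑ v, secCoef σ L v * prodCoef (onQubits Tᶜ u)⁻¹ w v := by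
  refine congrFun (Wop_coef_unique (f := fun w => ∑ v, secCoef σ L v * prodCoef (onQubits T u) w v)
    (g := fun w => ∑ v, secCoef σ L v * prodCoef (onQubits Tᶜ u)⁻¹ w v) ?_) w
  rw [← opOf_conj_sum, ← opOf_conj_sum]
  have h := opOf_mul_stabSum σ hu
  have hsplit : opOf u = opOf (onQubits Tᶜ u) * opOf (onQubits T u) := by
    rw [← opOf_mul, onQubits_mul_compl]
  rw [hsplit] at h
  change opOf (onQubits T u) * stabSum σ L * (opOf (onQubits T u))ᴴ =
    opOf (onQubits Tᶜ u)⁻¹ * stabSum σ L * (opOf (onQubits Tᶜ u)⁻¹)ᴴ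
  rw [← opOf_inv, ← opOf_inv, inv_inv]
  calc opOf (onQubits T u) * stabSum σ L * opOf (onQubits T u)⁻¹
      = (opOf (onQubits Tᶜ u)⁻¹ * opOf (onQubits Tᶜ u)) * opOf (onQubits T u) * stabSum σ L *
          opOf (onQubits T u)⁻¹ := by rw [opOf_inv_mul, one_mul]
    _ = opOf (onQubits Tᶜ u)⁻¹ * (opOf (onQubits Tᶜ u) * opOf (onQubits T u) * stabSum σ L) *
          opOf (onQubits T u)⁻¹ := by simp only [mul_assoc]
    _ = opOf (onQubits Tᶜ u)⁻¹ * stabSum σ L * opOf (onQubits Tᶜ u) *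
          (opOf (onQubits T u) * opOf (onQubits T u)⁻¹) := by rw [h]; simp only [mul_assoc]
    _ = _ := by rw [opOf_mul_inv, mul_one]

/-! ### Code-preserving families at a single qubit -/

theorem V_cases : ∀ a b c : V, a ≠ 0 → b ≠ 0 → c ≠ 0 → a ≠ b → c = a ∨ c = b ∨ c = a + b := by
  decide

theorem V_add_eq_zero : ∀ a b : V, a + b = 0 ↔ a = b := by decide

theorem omegaV_nondegenerate :
    ∀ a b c : V, a ≠ 0 → b ≠ 0 → a ≠ b → omegaV a c = 0 → omegaV b c = 0 → c = 0 := by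
  decide

section

variable {L : Submodule (ZMod 2) (QV P)} {σ : PauliSection L} {u : P → U2}

theorem sum_prodCoef_eq_zero (hu : u ∈ transversalGroup L σ) {T : Set P} {w : QV P}
    (h : ∀ v ∈ L, (∀ s, w s = 0 ↔ v s = 0) → ¬ ∀ s ∈ T, w s = v s) :
    ∑ v, secCoef σ L v * prodCoef (onQubits T u) w v = 0 := by
  rw [sum_prodCoef_onQubits σ hu]
  refine Finset.sum_eq_zero fun v _ => ?_
  by_contra hne
  have hv := (secCoef_ne_zero_iff σ).mp (left_ne_zero_of_mul hne)
  have hp := prodCoef_ne_zero (right_ne_zero_of_mul hne)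
  refine h v hv hp.1 fun s hs => hp.2 s ?_
  simp [onQubits, hs]

/-- If all vectors of `L` with the support of `y` agree at `p`, then the line spanned by the
Pauli operator of `y p` is preserved. -/
theorem conjCoef_eq_zero_of_const {y : QV P} (hy : y ∈ L) {p : P} (hyp : y p ≠ 0)
    (hconst : ∀ v ∈ L, (∀ s, v s = 0 ↔ y s = 0) → v p = y p)
    (hu : u ∈ transversalGroup L σ) {b : V} (hb : b ≠ y p) : conjCoef (u p) b (y p) = 0 := by
  by_cases hb0 : b = 0
  · rw [hb0, conjCoef_zero_left (U2_mul_conjTranspose _), if_neg hyp]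
  have hsum := sum_prodCoef_eq_zero (T := {p}) (w := Function.update y p b) hu (by
    intro v hv hs hT
    have h1 := hT p rfl
    rw [Function.update_self] at h1
    refine hb (h1.trans (hconst v hv fun s => ?_))
    rw [← hs s]
    by_cases hsp : s = p
    · subst hsp; simp [hb0, hyp]
    · rw [Function.update_of_ne hsp])
  rw [Finset.sum_eq_single y] at hsum
  · have h2 : prodCoef (onQubits {p} u) (Function.update y p b) y = conjCoef (u p) b (y p) := by
      rw [prodCoef, Finset.prod_eq_single p]
      · simp [onQubits]
      · intro s _ hs
        simp [onQubits, hs, conjCoef_one]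
      · simp
    rw [h2] at hsum
    exact (mul_eq_zero.mp hsum).resolve_left ((secCoef_ne_zero_iff σ).mpr hy)
  · intro v _ hvy
    by_contra hne
    have hv := (secCoef_ne_zero_iff σ).mp (left_ne_zero_of_mul hne)
    have hp := prodCoef_ne_zero (right_ne_zero_of_mul hne)
    have hoff : ∀ s, s ≠ p → v s = y s := by
      intro s hs
      have := hp.2 s (by simp [onQubits, hs])
      rw [Function.update_of_ne hs] at this
      exact this.symm
    refine hvy (funext fun s => ?_)
    by_cases hs : s = p
    · subst hs
      refine hconst v hv fun s' => ?_
      by_cases hs' : s' = s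
      · subst hs'
        rw [← hp.1 s']
        simp [hb0, hyp]
      · rw [hoff s' hs']
    · exact hoff s hs
  · simp

/-- If the vectors of `L` with the support of `y` are determined by any coordinate in this
support, which contains at least three qubits, then the lines spanned by Pauli operators
are permuted. -/
theorem exists_conjCoef_eq_zero_of_three {y : QV P} {p q r : P} (hpq : p ≠ q) (hpr : p ≠ r)
    (hqr : q ≠ r) (hyp : y p ≠ 0) (hyq : y q ≠ 0) (hyr : y r ≠ 0)
    (hinj : ∀ v ∈ L, ∀ v' ∈ L, (∀ s, v s = 0 ↔ y s = 0) → (∀ s, v' s = 0 ↔ y s = 0) →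
      ∀ s, y s ≠ 0 → v s = v' s → v = v')
    (hsurj : ∀ a, a ≠ 0 → ∃ v ∈ L, (∀ s, v s = 0 ↔ y s = 0) ∧ v p = a)
    (hu : u ∈ transversalGroup L σ) {a : V} (ha : a ≠ 0) :
    ∃ b, ∀ b', b' ≠ b → conjCoef (u p) b' a = 0 := by
  obtain ⟨x, hx, hxs, hxp⟩ := hsurj a ha
  have hxq : x q ≠ 0 := fun h => hyq ((hxs q).mp h)
  have key : ∀ k l : V, k ≠ 0 → l ≠ 0 → conjCoef (u p) k a ≠ 0 →
      conjCoef (u q) l (x q) ≠ 0 →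
      ∃ v ∈ L, (∀ s, v s = 0 ↔ y s = 0) ∧ v p = k ∧ v q = l := by
    intro k l hk hl hck hcl
    by_contra! hno
    set w := Function.update (Function.update x p k) q l with hw
    have hwp : w p = k := by rw [hw, Function.update_of_ne hpq, Function.update_self]
    have hwq : w q = l := by rw [hw, Function.update_self]
    have hwo : ∀ s, s ≠ p → s ≠ q → w s = x s := by
      intro s h1 h2
      rw [hw, Function.update_of_ne h2, Function.update_of_ne h1]
    have hws : ∀ s, w s = 0 ↔ y s = 0 := by
      intro s
      by_cases h1 : s = p
      · subst h1; rw [hwp]; exact ⟨fun h => absurd h hk, fun h => absurd h hyp⟩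
      by_cases h2 : s = q
      · subst h2; rw [hwq]; exact ⟨fun h => absurd h hl, fun h => absurd h hyq⟩
      rw [hwo s h1 h2, hxs]
    have hsum := sum_prodCoef_eq_zero (T := {p, q}) (w := w) hu (by
      intro v hv hs hT
      refine hno v hv (fun s => (hs s).symm.trans (hws s)) ?_ ?_
      · rw [← hT p (by simp), hwp]
      · rw [← hT q (by simp), hwq])
    rw [Finset.sum_eq_single x] at hsum
    · have h2 : prodCoef (onQubits {p, q} u) w x =
          conjCoef (u p) k a * conjCoef (u q) l (x q) := by
        rw [prodCoef, Fintype.prod_eq_mul p q hpq]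
        · simp [onQubits, hwp, hwq, hxp]
        · rintro s ⟨h1, h2⟩
          simp [onQubits, h1, h2, conjCoef_one, hwo s h1 h2]
      rw [h2] at hsum
      exact mul_ne_zero ((secCoef_ne_zero_iff σ).mpr hx) (mul_ne_zero hck hcl) hsum
    · intro v _ hvx
      by_contra hne
      have hv := (secCoef_ne_zero_iff σ).mp (left_ne_zero_of_mul hne)
      have hp := prodCoef_ne_zero (right_ne_zero_of_mul hne)
      have hr := hp.2 r (by simp [onQubits, hpr.symm, hqr.symm])
      rw [hwo r hpr.symm hqr.symm] at hr
      exact hvx (hinj v hv x hx (fun s => (hp.1 s).symm.trans (hws s)) hxs r hyr hr.symm)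
    · simp
  have hnz : ∀ (s : P) (k c : V), c ≠ 0 → conjCoef (u s) k c ≠ 0 → k ≠ 0 := by
    rintro s k c hc hne rfl
    rw [conjCoef_zero_left (U2_mul_conjTranspose _), if_neg hc] at hne
    exact hne rfl
  obtain ⟨b, hb⟩ := exists_conjCoef_ne_zero (U2_mul_conjTranspose (u p)) a
  obtain ⟨l, hl⟩ := exists_conjCoef_ne_zero (U2_mul_conjTranspose (u q)) (x q)
  have hl0 := hnz q l (x q) hxq hl
  refine ⟨b, fun b' hbb' => ?_⟩
  by_contra hb'
  obtain ⟨v, hv, hvs, hvp, hvq⟩ := key b l (hnz p b a ha hb) hl0 hb hl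
  obtain ⟨v', hv', hvs', hvp', hvq'⟩ := key b' l (hnz p b' a ha hb') hl0 hb' hl
  apply hbb'
  rw [← hvp, ← hvp', hinj v hv v' hv' hvs hvs' q hyq (hvq.trans hvq'.symm)]

/-- A code-preserving family, restricted to the qubits in `S`, commutes with the sum of the
stabilizers supported in `S`. -/
theorem onQubits_commute_stabSum (hu : u ∈ transversalGroup L σ) (S : Set P) :
    opOf (onQubits S u) * stabSum σ (LS L S) = stabSum σ (LS L S) * opOf (onQubits S u) := by
  have h : opOf (onQubits S u) * stabSum σ (LS L S) * (opOf (onQubits S u))ᴴ =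
      stabSum σ (LS L S) := by
    rw [stabSum, opOf_conj_sum]
    refine Finset.sum_congr rfl fun w _ => ?_
    congr 1
    have hmem : ∀ v : QV P, v ∈ LS L S ↔ v ∈ L ∧ ∀ s ∉ S, v s = 0 := fun v => Iff.rfl
    have hcoef : ∀ v : QV P, (∀ s ∉ S, v s = 0) → secCoef σ (LS L S) v = secCoef σ L v := by
      intro v hv
      simp only [secCoef, hmem, and_iff_left hv]
    by_cases hw : ∀ s ∉ S, w s = 0
    · rw [hcoef w hw]
      have h1 : ∑ v, secCoef σ (LS L S) v * prodCoef (onQubits S u) w v =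
          ∑ v, secCoef σ L v * prodCoef (onQubits S u) w v := by
        refine Finset.sum_congr rfl fun v _ => ?_
        by_cases h0 : prodCoef (onQubits S u) w v = 0
        · rw [h0, mul_zero, mul_zero]
        · rw [hcoef v fun s hs => ((prodCoef_ne_zero h0).1 s).mp (hw s hs)]
      rw [h1, sum_prodCoef_onQubits σ hu, Finset.sum_eq_single w]
      · have h2 : prodCoef (onQubits Sᶜ u)⁻¹ w w = 1 := by
          refine Finset.prod_eq_one fun s _ => ?_
          by_cases hs : s ∈ S
          · simp [onQubits, hs, conjCoef_one]
          · rw [hw s hs, conjCoef_zero_right (U2_mul_conjTranspose _), if_pos rfl]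
        rw [h2, mul_one]
      · intro v _ hvw
        by_contra hne
        have hp := prodCoef_ne_zero (right_ne_zero_of_mul hne)
        refine hvw (funext fun s => ?_)
        by_cases hs : s ∈ S
        · exact (hp.2 s (by simp [onQubits, hs])).symm
        · rw [hw s hs, (hp.1 s).mp (hw s hs)]
      · simp
    · have hw' : w ∉ LS L S := fun h => hw h.2
      rw [secCoef_eq_zero σ hw']
      refine Finset.sum_eq_zero fun v _ => ?_
      by_contra hne
      have hv := (secCoef_ne_zero_iff σ).mp (left_ne_zero_of_mul hne)
      have hp := prodCoef_ne_zero (right_ne_zero_of_mul hne)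
      exact hw fun s hs => (hp.1 s).mpr (hv.2 s hs)
  calc opOf (onQubits S u) * stabSum σ (LS L S)
      = opOf (onQubits S u) * stabSum σ (LS L S) *
          (opOf (onQubits S u)⁻¹ * opOf (onQubits S u)) := by rw [opOf_inv_mul, mul_one]
    _ = opOf (onQubits S u) * stabSum σ (LS L S) * (opOf (onQubits S u))ᴴ *
          opOf (onQubits S u) := by rw [← opOf_inv]; simp only [mul_assoc]
    _ = _ := by rw [h]

theorem stabSum_mulVec_Wop_eq_zero {M : Submodule (ZMod 2) (QV P)} (hM : M ≤ L) {v w : QV P}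
    (hv : v ∈ M) (hvw : omega v w ≠ 0) {ψ : HP P} (hψ : ψ ∈ code L σ) :
    stabSum σ M *ᵥ (Wop w *ᵥ ψ) = 0 := by
  have hcomm : σ.toFun v * Wop w = -(Wop w * σ.toFun v) := by
    rw [section_eq σ hv, Matrix.smul_mul, Wop_mul_comm, chi, if_neg hvw, Matrix.mul_smul]
    simp
  have h : stabSum σ M *ᵥ (Wop w *ᵥ ψ) = -(stabSum σ M *ᵥ (Wop w *ᵥ ψ)) := by
    nth_rewrite 1 [← stabSum_mul_section σ hM hv]
    rw [← Matrix.mulVec_mulVec, Matrix.mulVec_mulVec _ (σ.toFun v), hcomm, Matrix.neg_mulVec,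
      ← Matrix.mulVec_mulVec, hψ v (hM hv), Matrix.mulVec_neg]
  exact self_eq_neg.mp h

/-- If the stabilizers supported in `S` form a maximal isotropic subspace of `V^S`, then the
restriction to `S` of a code-preserving family acts by a scalar on the code. -/
theorem onQubits_mem_scalarGroup {S : Set P}
    (hmax : ∀ w ∈ coordSub S, w ∈ L ∨ ∃ v ∈ LS L S, omega v w ≠ 0)
    (hu : u ∈ transversalGroup L σ) : onQubits S u ∈ scalarGroup L σ := by
  have hM : LS L S ≤ L := inf_le_left
  set m : QV P → ℂ := fun w => ∏ p, pauliCoef (onQubits S u p) (w p) with hm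
  have hterm : ∀ w : QV P, ∃ d : ℂ, ∀ ψ ∈ code L σ,
      stabSum σ (LS L S) *ᵥ ((m w • Wop w) *ᵥ ψ) = d • ψ := by
    intro w
    by_cases hw : w ∈ coordSub S
    · rcases hmax w hw with hwL | ⟨v, hv, hvw⟩
      · refine ⟨m w * (secCoef σ L w)⁻¹ * (Fintype.card (LS L S) : ℂ), fun ψ hψ => ?_⟩
        have hc := (secCoef_ne_zero_iff σ).mpr hwL
        have h1 : Wop w *ᵥ ψ = (secCoef σ L w)⁻¹ • ψ := by
          have h2 := hψ w hwL
          rw [section_eq σ hwL, Matrix.smul_mulVec] at h2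
          rw [← h2, smul_smul, inv_mul_cancel₀ hc, one_smul, h2]
        rw [Matrix.smul_mulVec, h1, Matrix.mulVec_smul, Matrix.mulVec_smul,
          stabSum_mulVec σ hM hψ, smul_smul, smul_smul]
      · refine ⟨0, fun ψ hψ => ?_⟩
        rw [Matrix.smul_mulVec, Matrix.mulVec_smul, stabSum_mulVec_Wop_eq_zero hM hv hvw hψ,
          smul_zero, zero_smul]
    · have hmw : m w = 0 := by
        have : ∃ s, s ∉ S ∧ w s ≠ 0 := by
          by_contra! h
          exact hw h
        obtain ⟨s, hs, hws⟩ := this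
        refine Finset.prod_eq_zero (Finset.mem_univ s) ?_
        have := pauliCoef_pauliMat 0 (w s)
        rw [pauliMat_zero, if_neg hws] at this
        simpa [onQubits, hs] using this
      exact ⟨0, fun ψ _ => by simp [hmw]⟩
  choose d hd using hterm
  have hcard : (Fintype.card (LS L S) : ℂ) ≠ 0 := Nat.cast_ne_zero.mpr Fintype.card_ne_zero
  refine ⟨(Fintype.card (LS L S) : ℂ)⁻¹ * ∑ w, d w, fun ψ hψ => ?_⟩
  have h1 : (Fintype.card (LS L S) : ℂ) • (opOf (onQubits S u) *ᵥ ψ) = (∑ w, d w) • ψ := by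
    rw [← Matrix.mulVec_smul, ← stabSum_mulVec σ hM hψ, Matrix.mulVec_mulVec,
      onQubits_commute_stabSum hu, ← Matrix.mulVec_mulVec, opOf, locOp_expand,
      Matrix.sum_mulVec, Matrix.mulVec_sum, Finset.sum_smul]
    exact Finset.sum_congr rfl fun w _ => hd w ψ hψ
  rw [mul_smul, ← h1, smul_smul, inv_mul_cancel₀ hcard, one_smul]

end

/-! ### The structure of code-preserving families -/

/-- At each qubit, all code-preserving families preserve the line spanned by a Pauli operator,
or permute the lines spanned by Pauli operators, or act by a scalar on the code after
restriction to a set of qubits containing the given one. -/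
theorem transversal_trichotomy {L : Submodule (ZMod 2) (QV P)} (hL : Isotropic L)
    (hzero : ¬ HasZeroFactor L) (σ : PauliSection L) (p : P) :
    (∃ a : V, a ≠ 0 ∧ ∀ u ∈ transversalGroup L σ, ∀ b, b ≠ a → conjCoef (u p) b a = 0) ∨
    (∀ u ∈ transversalGroup L σ, ∀ a : V, a ≠ 0 →
      ∃ b, ∀ b', b' ≠ b → conjCoef (u p) b' a = 0) ∨
    ∃ S : Set P, p ∈ S ∧ ∀ u ∈ transversalGroup L σ, onQubits S u ∈ scalarGroup L σ := by
  obtain ⟨y, hy, hyp, hmin⟩ : ∃ y ∈ L, y p ≠ 0 ∧ ∀ v ∈ L, v p ≠ 0 →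
      (∀ s, y s = 0 → v s = 0) → ∀ s, v s = 0 ↔ y s = 0 := by
    have hex : ∃ v ∈ L, v p ≠ 0 := by
      by_contra! h
      exact hzero ⟨{p}, Set.singleton_nonempty p, fun v hv q hq => by
        rw [Set.mem_singleton_iff.mp hq]; exact h v hv⟩
    obtain ⟨v₀, hv₀, hv₀p⟩ := hex
    obtain ⟨y, hy, hymin⟩ := Finset.exists_min_image
      (Finset.univ.filter fun v : QV P => v ∈ L ∧ v p ≠ 0)
      (fun v => (Finset.univ.filter fun s => v s ≠ 0).card) ⟨v₀, by simp [hv₀, hv₀p]⟩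
    simp only [Finset.mem_filter, Finset.mem_univ, true_and] at hy hymin
    refine ⟨y, hy.1, hy.2, fun v hv hvp hvy => ?_⟩
    have hsub : (Finset.univ.filter fun s => v s ≠ 0) ⊆ Finset.univ.filter fun s => y s ≠ 0 := by
      intro s
      simp only [Finset.mem_filter, Finset.mem_univ, true_and]
      exact mt (hvy s)
    have heq := Finset.eq_of_subset_of_card_le hsub (hymin v ⟨hv, hvp⟩)
    intro s
    have := congrArg (s ∈ ·) heq
    simpa [not_iff_not] using this
  by_cases hconst : ∀ v ∈ L, (∀ s, v s = 0 ↔ y s = 0) → v p = y p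
  · exact Or.inl ⟨y p, hyp, fun u hu b hb => conjCoef_eq_zero_of_const hy hyp hconst hu hb⟩
  right
  push Not at hconst
  obtain ⟨z, hz, hzs, hzp⟩ := hconst
  have hzp0 : z p ≠ 0 := fun h => hyp ((hzs p).mp h)
  have hyzp : (y + z) p ≠ 0 := fun h => hzp ((V_add_eq_zero _ _).mp h).symm
  have hyz : y + z ∈ L := L.add_mem hy hz
  have hyzs := hmin (y + z) hyz hyzp fun s hs => by simp [hs, (hzs s).mpr hs]
  have hne : ∀ s, y s ≠ 0 → y s ≠ z s := fun s hs h =>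
    hs ((hyzs s).mp ((V_add_eq_zero _ _).mpr h))
  have hrep : ∀ s, y s ≠ 0 → ∀ c : V, c ≠ 0 →
      ∃ v ∈ L, (∀ s, v s = 0 ↔ y s = 0) ∧ v s = c := by
    intro s hs c hc
    rcases V_cases (y s) (z s) c hs (fun h => hs ((hzs s).mp h)) hc (hne s hs) with h | h | h
    · exact ⟨y, hy, fun _ => Iff.rfl, h.symm⟩
    · exact ⟨z, hz, hzs, h.symm⟩
    · exact ⟨y + z, hyz, hyzs, h.symm⟩
  have hsupp : ∀ v ∈ L, (∀ s, y s = 0 → v s = 0) → v p = 0 → v = 0 := by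
    intro v hv hvy hvp
    by_contra hv0
    obtain ⟨s, hs⟩ := Function.ne_iff.mp hv0
    have hys : y s ≠ 0 := fun h => hs (hvy s h)
    obtain ⟨e, he, hes, hev⟩ := hrep s hys (v s) hs
    have h1 : (e + v) p ≠ 0 := by
      rw [Pi.add_apply, hvp, add_zero]
      exact fun h => hyp ((hes p).mp h)
    have h2 := hmin (e + v) (L.add_mem he hv) h1 fun s hs => by simp [hvy s hs, (hes s).mpr hs]
    exact hys ((h2 s).mp ((V_add_eq_zero _ _).mpr hev))
  have hinj : ∀ v ∈ L, ∀ v' ∈ L, (∀ s, v s = 0 ↔ y s = 0) → (∀ s, v' s = 0 ↔ y s = 0) →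
      ∀ s, y s ≠ 0 → v s = v' s → v = v' := by
    intro v hv v' hv' hvs hvs' s hs hvv
    have hsub : ∀ s, y s = 0 → (v + v') s = 0 := fun s hs => by
      simp [(hvs s).mpr hs, (hvs' s).mpr hs]
    have hvp : (v + v') p = 0 := by
      by_contra h
      exact hs ((hmin _ (L.add_mem hv hv') h hsub s).mp ((V_add_eq_zero _ _).mpr hvv))
    have h0 := hsupp _ (L.add_mem hv hv') hsub hvp
    exact funext fun s => (V_add_eq_zero _ _).mp (congrFun h0 s)
  by_cases hthree : ∃ q r, p ≠ q ∧ p ≠ r ∧ q ≠ r ∧ y q ≠ 0 ∧ y r ≠ 0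
  · obtain ⟨q, r, hpq, hpr, hqr, hyq, hyr⟩ := hthree
    exact Or.inl fun u hu a ha => exists_conjCoef_eq_zero_of_three hpq hpr hqr hyp hyq hyr hinj
      (hrep p hyp) hu ha
  right
  refine ⟨supp y, hyp, fun u hu => onQubits_mem_scalarGroup ?_ hu⟩
  have hmem : ∀ v ∈ L, (∀ s, v s = 0 ↔ y s = 0) → v ∈ LS L (supp y) := fun v hv hvs =>
    ⟨hv, fun s hs => (hvs s).mpr (not_not.mp hs)⟩
  obtain ⟨q, hqp, hyq⟩ : ∃ q, q ≠ p ∧ y q ≠ 0 := by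
    by_contra! h
    have h1 : omega y z = omegaV (y p) (z p) := by
      refine Finset.sum_eq_single p (fun s _ hs => ?_) (by simp)
      rw [h s hs]
      simp [omegaV]
    have h2 : omegaV (y p) (y p) = 0 := by
      have : ∀ a : V, omegaV a a = 0 := by decide
      exact this _
    have h3 : ∀ a b : V, omegaV a b = omegaV b a := by decide
    refine hyp (omegaV_nondegenerate (y p) (z p) (y p) hyp hzp0 (hne p hyp) h2 ?_)
    rw [h3, ← h1]
    exact hL y hy z hz
  have honly : ∀ s, s ≠ p → s ≠ q → y s = 0 := by
    intro s h1 h2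
    by_contra h
    exact hthree ⟨q, s, hqp.symm, h1.symm, h2.symm, hyq, h⟩
  intro w hw
  by_contra! hcon
  obtain ⟨hwL, hwo⟩ := hcon
  obtain ⟨x, hx, hxw⟩ : ∃ x ∈ LS L (supp y), x p = w p := by
    by_cases h : w p = 0
    · exact ⟨0, Submodule.zero_mem _, h.symm⟩
    · obtain ⟨v, hv, hvs, hvp⟩ := hrep p hyp (w p) h
      exact ⟨v, hmem v hv hvs, hvp⟩
  have hout : ∀ s, y s = 0 → w s = 0 ∧ x s = 0 := fun s hs =>
    ⟨hw s (not_not.mpr hs), hx.2 s (not_not.mpr hs)⟩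
  have homega : ∀ v ∈ L, (∀ s, v s = 0 ↔ y s = 0) → omegaV (v q) ((w + x) q) = 0 := by
    intro v hv hvs
    have h1 : omega v (w + x) = omega v w + omega v x := by
      simp only [omega, ← Finset.sum_add_distrib]
      refine Finset.sum_congr rfl fun s _ => ?_
      simp only [omegaV, Pi.add_apply, Prod.fst_add, Prod.snd_add]
      ring
    rw [hwo v (hmem v hv hvs), hL v hv x hx.1, add_zero] at h1
    rw [← h1, omega, Finset.sum_eq_single q]
    · intro s _ hs
      have : (w + x) s = 0 := by
        by_cases hsp : s = p
        · rw [hsp]; exact (V_add_eq_zero _ _).mpr hxw.symm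
        · obtain ⟨h1, h2⟩ := hout s (honly s hsp hs)
          simp [h1, h2]
      rw [this]
      simp [omegaV]
    · simp
  have hq := omegaV_nondegenerate (y q) (z q) ((w + x) q) hyq (fun h => hyq ((hzs q).mp h))
    (hne q hyq) (homega y hy fun _ => Iff.rfl) (homega z hz hzs)
  apply hwL
  have hwx : w = x := by
    funext s
    by_cases hsp : s = p
    · rw [hsp, hxw]
    by_cases hsq : s = q
    · rw [hsq]; exact (V_add_eq_zero _ _).mp hq
    obtain ⟨h1, h2⟩ := hout s (honly s hsp hsq)
    rw [h1, h2]
  rw [hwx]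
  exact hx.1

/-- Families acting by a scalar at every qubit outside sets to which code-preserving families
restrict as scalars act by a scalar on the code. -/
theorem mem_scalarGroup_of_local {L : Submodule (ZMod 2) (QV P)} (σ : PauliSection L)
    {u : P → U2} (hu : u ∈ transversalGroup L σ)
    (h : ∀ p, (∃ c : ℂ, (u p : Matrix (Fin 2) (Fin 2) ℂ) = c • 1) ∨
      ∃ S : Set P, p ∈ S ∧ ∀ u ∈ transversalGroup L σ, onQubits S u ∈ scalarGroup L σ) :
    u ∈ scalarGroup L σ := by
  induction hn : (Finset.univ.filter fun p => u p ≠ 1).card using Nat.strong_induction_on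
    generalizing u with
  | _ n ih =>
  by_cases hB : ∃ p, u p ≠ 1 ∧
      ∃ S : Set P, p ∈ S ∧ ∀ u ∈ transversalGroup L σ, onQubits S u ∈ scalarGroup L σ
  · obtain ⟨p, hp, S, hpS, hS⟩ := hB
    have hmul : u = onQubits Sᶜ u * onQubits S u := (onQubits_mul_compl S u).symm
    have hSu := hS u hu
    have hle : ∀ v ∈ scalarGroup L σ, v ∈ transversalGroup L σ := by
      rintro v ⟨c, hc⟩ ψ hψ
      rw [hc ψ hψ]
      exact (code L σ).smul_mem c hψ
    have hrest : onQubits Sᶜ u ∈ transversalGroup L σ := by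
      have : onQubits Sᶜ u = u * (onQubits S u)⁻¹ := by
        nth_rewrite 2 [hmul]
        rw [mul_inv_cancel_right]
      rw [this]
      exact mul_mem hu (inv_mem (hle _ hSu))
    have hlt : (Finset.univ.filter fun q => onQubits Sᶜ u q ≠ 1).card < n := by
      rw [← hn]
      refine Finset.card_lt_card ⟨fun q => ?_, fun hsub => ?_⟩
      · simp only [Finset.mem_filter, Finset.mem_univ, true_and]
        intro h1 h2
        apply h1
        simp [onQubits, h2]
      · have := hsub (Finset.mem_filter.mpr ⟨Finset.mem_univ p, hp⟩)
        simp [onQubits, hpS] at this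
    rw [hmul]
    refine mul_mem (ih _ hlt hrest (fun q => ?_) rfl) hSu
    rcases h q with ⟨c, hc⟩ | hq
    · left
      by_cases hqS : q ∈ S
      · exact ⟨1, by simp [onQubits, hqS]⟩
      · exact ⟨c, by simp [onQubits, hqS, hc]⟩
    · exact Or.inr hq
  · have hsc : ∀ p, ∃ c : ℂ, (u p : Matrix (Fin 2) (Fin 2) ℂ) = c • 1 := by
      intro p
      rcases h p with hc | hS
      · exact hc
      · have : u p = 1 := by
          by_contra hp
          exact hB ⟨p, hp, hS⟩
        exact ⟨1, by simp [this]⟩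
    choose c hc using hsc
    refine ⟨∏ p, c p, fun ψ _ => ?_⟩
    simp only [opOf, hc]
    rw [locOp_smul, locOp_one, Matrix.smul_mulVec, Matrix.one_mulVec]

/-! ### Solvability -/

theorem conj_smul_of_conjCoef {u : U2} {a b : V} (h : ∀ b', b' ≠ b → conjCoef u b' a = 0) :
    ∃ c : ℂ, u.1 * pauliMat a = c • (pauliMat b * u.1) := by
  have h1 := conj_pauliMat u a
  rw [Finset.sum_eq_single b (fun b' _ hb' => by rw [h b' hb', zero_smul]) (by simp)] at h1
  refine ⟨conjCoef u b a, ?_⟩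
  calc u.1 * pauliMat a
      = u.1 * pauliMat a * (u.1ᴴ * u.1) := by rw [U2_conjTranspose_mul, mul_one]
    _ = u.1 * pauliMat a * u.1ᴴ * u.1 := by simp only [mul_assoc]
    _ = _ := by rw [h1, Matrix.smul_mul]

theorem U2_mul_right_cancel (u : U2) {m n : Matrix (Fin 2) (Fin 2) ℂ} (h : m * u.1 = n * u.1) :
    m = n := by
  have := congrArg (· * u.1ᴴ) h
  simpa [mul_assoc, U2_mul_conjTranspose] using this

theorem U2_mul_pauliMat_ne_zero (u : U2) (a : V) : u.1 * pauliMat a ≠ 0 := by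
  intro h
  apply pauliMat_ne_zero a
  rw [← one_mul (pauliMat a), ← U2_conjTranspose_mul u, mul_assoc, h, mul_zero]

theorem conj_unique {u : U2} {a b b' : V} {c c' : ℂ}
    (h : u.1 * pauliMat a = c • (pauliMat b * u.1))
    (h' : u.1 * pauliMat a = c' • (pauliMat b' * u.1)) : b = b' := by
  have hc : c ≠ 0 := by
    rintro rfl
    exact U2_mul_pauliMat_ne_zero u a (by rw [h, zero_smul])
  have h1 : c • pauliMat b = c' • pauliMat b' := by
    apply U2_mul_right_cancel u
    rw [Matrix.smul_mul, Matrix.smul_mul, ← h, ← h']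
  have h2 := congrArg (fun m => pauliCoef m b) h1
  have hs : ∀ (x : ℂ) (d : V), pauliCoef (x • pauliMat d) b = x * if b = d then 1 else 0 := by
    intro x d
    rw [← pauliCoef_pauliMat d b, pauliCoef, pauliCoef, Matrix.mul_smul, Matrix.trace_smul,
      smul_eq_mul]
    ring
  simp only [hs, if_true, mul_one] at h2
  by_contra hb
  rw [if_neg hb, mul_zero] at h2
  exact hc h2

section Derived

open scoped commutatorElement

variable {G : Type} [Group G] (f : G →* U2)

/-- The elements whose image commutes with a given Pauli operator. -/
def pauliCentralizer (a : V) : Subgroup G where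
  carrier := {g | (f g).1 * pauliMat a = pauliMat a * (f g).1}
  mul_mem' := by
    intro g h hg hh
    change (f (g * h)).1 * pauliMat a = pauliMat a * (f (g * h)).1
    rw [map_mul]
    change (f g).1 * (f h).1 * pauliMat a = pauliMat a * ((f g).1 * (f h).1)
    rw [mul_assoc, Set.mem_ofPred_eq.mp hh, ← mul_assoc, Set.mem_ofPred_eq.mp hg, mul_assoc]
  one_mem' := by simp
  inv_mem' := by
    intro g hg
    change (f g⁻¹).1 * pauliMat a = pauliMat a * (f g⁻¹).1
    rw [map_inv]
    change (f g).1ᴴ * pauliMat a = pauliMat a * (f g).1ᴴ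
    apply U2_mul_right_cancel (f g)
    rw [mul_assoc, ← Set.mem_ofPred_eq.mp hg, ← mul_assoc, U2_conjTranspose_mul, one_mul,
      mul_assoc, U2_conjTranspose_mul, mul_one]

theorem mem_pauliCentralizer {a : V} {g : G} :
    g ∈ pauliCentralizer f a ↔ (f g).1 * pauliMat a = pauliMat a * (f g).1 := Iff.rfl

/-- The elements whose image is a scalar. -/
def scalarAt : Subgroup G := ⨅ a, pauliCentralizer f a

theorem exists_smul_of_mem_scalarAt {g : G} (hg : g ∈ scalarAt f) :
    ∃ c : ℂ, (f g : Matrix (Fin 2) (Fin 2) ℂ) = c • 1 :=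
  ⟨_, eq_smul_one_of_commute fun a => Subgroup.mem_iInf.mp hg a⟩

theorem coe_map_mul (g h : G) : (f (g * h)).1 = (f g).1 * (f h).1 := by
  rw [map_mul]
  rfl

/-- Commutators of elements preserving the line of a Pauli operator centralize it. -/
theorem commutator_le_pauliCentralizer {K : Subgroup G} {a : V}
    (hK : ∀ g ∈ K, ∃ c : ℂ, (f g).1 * pauliMat a = c • (pauliMat a * (f g).1)) :
    ⁅K, K⁆ ≤ pauliCentralizer f a := by
  rw [Subgroup.commutator_le]
  intro g hg h hh
  obtain ⟨c, hc⟩ := hK g hg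
  obtain ⟨d, hd⟩ := hK h hh
  have hgh : (f (g * h)).1 * pauliMat a = (c * d) • (pauliMat a * (f (g * h)).1) := by
    rw [coe_map_mul, mul_assoc, hd, Matrix.mul_smul, ← mul_assoc, hc, Matrix.smul_mul, smul_smul,
      mul_assoc, mul_comm d c]
  have hhg : (f (h * g)).1 * pauliMat a = (c * d) • (pauliMat a * (f (h * g)).1) := by
    rw [coe_map_mul, mul_assoc, hc, Matrix.mul_smul, ← mul_assoc, hd, Matrix.smul_mul, smul_smul,
      mul_assoc]
  have hcd : c * d ≠ 0 := by
    intro h0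
    exact U2_mul_pauliMat_ne_zero (f (g * h)) a (by rw [hgh, h0, zero_smul])
  have hcomm : ⁅g, h⁆ * (h * g) = g * h := by simp [commutatorElement_def]
  rw [mem_pauliCentralizer]
  apply U2_mul_right_cancel (f (h * g))
  apply smul_right_injective _ hcd
  change (c * d) • ((f ⁅g, h⁆).1 * pauliMat a * (f (h * g)).1) =
    (c * d) • (pauliMat a * (f ⁅g, h⁆).1 * (f (h * g)).1)
  rw [mul_assoc, ← Matrix.mul_smul, ← hhg, ← mul_assoc, ← coe_map_mul, hcomm, hgh, mul_assoc,
    ← coe_map_mul, hcomm]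

/-- The centralizer of a nontrivial Pauli operator is commutative modulo the kernel. -/
theorem commutator_pauliCentralizer_le {a : V} (ha : a ≠ 0) :
    ⁅pauliCentralizer f a, pauliCentralizer f a⁆ ≤ scalarAt f := by
  rw [Subgroup.commutator_le]
  intro g hg h hh
  have h1 : f g * f h = f h * f g := Subtype.ext (commute_of_commute_pauliMat ha hg hh)
  have h2 : f ⁅g, h⁆ = 1 := by
    rw [map_commutatorElement, commutatorElement_eq_one_iff_mul_comm, h1]
  rw [scalarAt, Subgroup.mem_iInf]
  intro b
  rw [mem_pauliCentralizer, h2]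
  simp

theorem derivedSeries_le_scalarAt_of_line {a : V} (ha : a ≠ 0)
    (h : ∀ g : G, ∃ c : ℂ, (f g).1 * pauliMat a = c • (pauliMat a * (f g).1)) :
    derivedSeries G 3 ≤ scalarAt f := by
  refine (derivedSeries_antitone G (show 2 ≤ 3 by norm_num)).trans ?_
  have h1 : derivedSeries G 1 ≤ pauliCentralizer f a :=
    commutator_le_pauliCentralizer f fun g _ => h g
  exact (Subgroup.commutator_mono h1 h1).trans (commutator_pauliCentralizer_le f ha)

theorem perm_fin_three_commute : ∀ s t : Equiv.Perm (Fin 3), Equiv.Perm.sign s = 1 →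
    Equiv.Perm.sign t = 1 → s * t = t * s := by
  decide

theorem derivedSeries_le_scalarAt_of_perm
    (h : ∀ g : G, ∀ a : V, a ≠ 0 →
      ∃ b, ∃ c : ℂ, (f g).1 * pauliMat a = c • (pauliMat b * (f g).1)) :
    derivedSeries G 3 ≤ scalarAt f := by
  have hex : ∀ g : G, ∀ a : {a : V // a ≠ 0}, ∃ b : {b : V // b ≠ 0}, ∃ c : ℂ,
      (f g).1 * pauliMat a = c • (pauliMat b * (f g).1) := by
    rintro g ⟨a, ha⟩
    obtain ⟨b, c, hbc⟩ := h g a ha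
    refine ⟨⟨b, ?_⟩, c, hbc⟩
    rintro rfl
    have h1 : pauliMat a = c • 1 := by
      have h2 := congrArg ((f g).1ᴴ * ·) hbc
      simpa [← mul_assoc, U2_conjTranspose_mul, pauliMat_zero] using h2
    refine ha (conj_unique (u := 1) (a := a) (c := 1) (c' := c) ?_ ?_)
    · simp
    · simp [h1, pauliMat_zero]
  choose perm hperm using hex
  have huniq : ∀ g (a b : {a : V // a ≠ 0}) (c : ℂ),
      (f g).1 * pauliMat a = c • (pauliMat b * (f g).1) → perm g a = b := by
    intro g a b c hb
    obtain ⟨c', hc'⟩ := hperm g a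
    exact Subtype.ext (conj_unique hc' hb)
  let φ : G →* Function.End {a : V // a ≠ 0} :=
    { toFun := perm
      map_one' := funext fun a => huniq 1 a a 1 (by simp)
      map_mul' := fun g k => funext fun a => by
        obtain ⟨c, hc⟩ := hperm k a
        obtain ⟨d, hd⟩ := hperm g (perm k a)
        refine huniq (g * k) a (perm g (perm k a)) (c * d) ?_
        rw [coe_map_mul, mul_assoc, hc, Matrix.mul_smul, ← mul_assoc, hd, Matrix.smul_mul,
          smul_smul, mul_assoc] }
  let e : {a : V // a ≠ 0} ≃ Fin 3 := Fintype.equivFinOfCardEq (by decide)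
  let ψ : G →* Equiv.Perm (Fin 3) := (e.permCongrHom.toMonoidHom).comp φ.toHomPerm
  have h1 : derivedSeries G 1 ≤ (Equiv.Perm.sign.comp ψ).ker := by
    refine Subgroup.commutator_le.mpr fun g _ k _ => ?_
    rw [MonoidHom.mem_ker, map_commutatorElement, commutatorElement_eq_one_iff_mul_comm, mul_comm]
  have h2 : derivedSeries G 2 ≤ ψ.ker := by
    refine (Subgroup.commutator_mono h1 h1).trans (Subgroup.commutator_le.mpr fun g hg k hk => ?_)
    rw [MonoidHom.mem_ker, map_commutatorElement, commutatorElement_eq_one_iff_mul_comm]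
    exact perm_fin_three_commute _ _ hg hk
  refine le_iInf fun a => ?_
  by_cases ha : a = 0
  · intro g _
    rw [mem_pauliCentralizer, ha, pauliMat_zero, mul_one, one_mul]
  refine commutator_le_pauliCentralizer f fun g hg => ?_
  have h3 : φ.toHomPerm g = 1 := by
    have := h2 hg
    rw [MonoidHom.mem_ker] at this
    exact e.permCongrHom.injective (this.trans (map_one _).symm)
  obtain ⟨c, hc⟩ := hperm g ⟨a, ha⟩
  have h4 : perm g ⟨a, ha⟩ = ⟨a, ha⟩ := congrArg (fun s : Equiv.Perm _ => s ⟨a, ha⟩) h3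
  rw [h4] at hc
  exact ⟨c, hc⟩

end Derived

/-- The third derived subgroup of the group of code-preserving families acts on the code by
scalars. -/
theorem derivedSeries_transversalGroup_le {L : Submodule (ZMod 2) (QV P)} (hL : Isotropic L)
    (hzero : ¬ HasZeroFactor L) (σ : PauliSection L) {u : transversalGroup L σ}
    (hu : u ∈ derivedSeries (transversalGroup L σ) 3) : u.1 ∈ scalarGroup L σ := by
  refine mem_scalarGroup_of_local σ u.2 fun p => ?_
  let f : transversalGroup L σ →* U2 :=
    (Pi.evalMonoidHom (fun _ : P => U2) p).comp (transversalGroup L σ).subtype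
  rcases transversal_trichotomy hL hzero σ p with ⟨a, ha, h⟩ | h | h
  · exact Or.inl (exists_smul_of_mem_scalarAt f (derivedSeries_le_scalarAt_of_line f ha
      (fun g => conj_smul_of_conjCoef (h g.1 g.2)) hu))
  · refine Or.inl (exists_smul_of_mem_scalarAt f (derivedSeries_le_scalarAt_of_perm f
      (fun g a ha => ?_) hu))
    obtain ⟨b, hb⟩ := h g.1 g.2 a ha
    exact ⟨b, conj_smul_of_conjCoef hb⟩
  · exact Or.inr h

/-! ### The adjoint action -/

theorem pauliBasis_conjTranspose (i : Fin 3) : (pauliBasis i)ᴴ = pauliBasis i := by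
  fin_cases i <;> ext a b <;> fin_cases a <;> fin_cases b <;>
    simp [pauliBasis, sigmaX, sigmaY, sigmaZ, Matrix.conjTranspose_apply]

theorem trace_pauliBasis (i : Fin 3) : (pauliBasis i).trace = 0 := by
  fin_cases i <;> simp [pauliBasis, sigmaX, sigmaY, sigmaZ, Matrix.trace_fin_two]

theorem eq_sum_pauliBasis {m : Matrix (Fin 2) (Fin 2) ℂ} (hm : m.trace = 0) :
    m = ∑ i, ((1 / 2 : ℂ) * (pauliBasis i * m).trace) • pauliBasis i := by
  rw [Matrix.trace_fin_two] at hm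
  have h11 : m 1 1 = -m 0 0 := by linear_combination hm
  rw [Matrix.eta_fin_two m, h11, Fin.sum_univ_three]
  ext a b
  fin_cases a <;> fin_cases b <;>
    simp [pauliBasis, sigmaX, sigmaY, sigmaZ, Matrix.trace_fin_two] <;> ring_nf <;>
    simp <;> ring

theorem ofReal_adjRot (u : Matrix (Fin 2) (Fin 2) ℂ) (i j : Fin 3) :
    (adjRot u i j : ℂ) = (1 / 2 : ℂ) * (pauliBasis i * (u * pauliBasis j * uᴴ)).trace := by
  have h : (starRingEnd ℂ) (pauliBasis i * u * pauliBasis j * uᴴ).trace =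
      (pauliBasis i * u * pauliBasis j * uᴴ).trace := by
    have h1 := Matrix.trace_conjTranspose (pauliBasis i * u * pauliBasis j * uᴴ)
    rw [starRingEnd_apply, ← h1]
    simp only [Matrix.conjTranspose_mul, Matrix.conjTranspose_conjTranspose,
      pauliBasis_conjTranspose]
    rw [← mul_assoc, ← mul_assoc, Matrix.trace_mul_comm, ← mul_assoc, ← mul_assoc]
  rw [← mul_assoc, ← mul_assoc, ← Complex.conj_eq_iff_re.mp h]
  simp [adjRot]

theorem conj_pauliBasis (u : U2) (j : Fin 3) :
    u.1 * pauliBasis j * u.1ᴴ = ∑ i, (adjRot u.1 i j : ℂ) • pauliBasis i := by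
  have h : (u.1 * pauliBasis j * u.1ᴴ).trace = 0 := by
    rw [Matrix.trace_mul_comm, ← mul_assoc, U2_conjTranspose_mul, one_mul, trace_pauliBasis]
  rw [eq_sum_pauliBasis h]
  exact Finset.sum_congr rfl fun i _ => by rw [ofReal_adjRot]

theorem adjRot_mul (u v : U2) : adjRot (u.1 * v.1) = adjRot u.1 * adjRot v.1 := by
  ext i j
  apply Complex.ofReal_injective
  rw [ofReal_adjRot, Matrix.conjTranspose_mul,
    show u.1 * v.1 * pauliBasis j * (v.1ᴴ * u.1ᴴ) = u.1 * (v.1 * pauliBasis j * v.1ᴴ) * u.1ᴴ by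
      simp only [mul_assoc], conj_pauliBasis v, Matrix.mul_apply]
  push_cast
  simp only [Matrix.sum_mul, Matrix.trace_sum, Matrix.mul_smul, Matrix.smul_mul,
    Matrix.trace_smul, smul_eq_mul, Finset.mul_sum]
  refine Finset.sum_congr rfl fun k _ => ?_
  rw [ofReal_adjRot u.1]
  ring

theorem adjRot_one : adjRot 1 = 1 := by
  ext i j
  fin_cases i <;> fin_cases j <;>
    simp [adjRot, pauliBasis, sigmaX, sigmaY, sigmaZ, Matrix.trace_fin_two] <;> norm_num

theorem adjRot_smul_one {c : ℂ} (hc : ‖c‖ = 1) : adjRot (c • 1) = 1 := by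
  have h : c * (starRingEnd ℂ) c = 1 := by
    rw [Complex.mul_conj, Complex.normSq_eq_norm_sq, hc]
    simp
  rw [← adjRot_one]
  ext i j
  simp only [adjRot, Matrix.of_apply, Matrix.conjTranspose_smul, Matrix.mul_smul, Matrix.smul_mul,
    smul_smul, Matrix.conjTranspose_one, Complex.star_def, mul_comm _ c, h, one_smul]

theorem adjRot_conjTranspose (u : Matrix (Fin 2) (Fin 2) ℂ) : adjRot uᴴ = (adjRot u)ᵀ := by
  ext i j
  apply Complex.ofReal_injective
  rw [Matrix.transpose_apply, ofReal_adjRot, ofReal_adjRot, Matrix.conjTranspose_conjTranspose,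
    ← mul_assoc, ← mul_assoc, Matrix.trace_mul_comm, ← mul_assoc, ← mul_assoc,
    Matrix.trace_mul_comm, ← mul_assoc, ← mul_assoc]

theorem adjRot_mem_SO3 (u : U2) : adjRot u.1 ∈ SO3 := by
  constructor
  · rw [← adjRot_conjTranspose]
    change adjRot u.1 * adjRot (u⁻¹).1 = 1
    rw [← adjRot_mul, ← adjRot_one]
    exact congrArg adjRot (U2_mul_conjTranspose u)
  · have h1 : ((u.1 * pauliBasis 0 * u.1ᴴ) * (u.1 * pauliBasis 1 * u.1ᴴ) *
        (u.1 * pauliBasis 2 * u.1ᴴ)).trace = 2 * Complex.I := by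
      have : (u.1 * pauliBasis 0 * u.1ᴴ) * (u.1 * pauliBasis 1 * u.1ᴴ) *
          (u.1 * pauliBasis 2 * u.1ᴴ) =
          u.1 * (pauliBasis 0 * (u.1ᴴ * u.1) * pauliBasis 1 * (u.1ᴴ * u.1) * pauliBasis 2) *
            u.1ᴴ := by
        simp only [mul_assoc]
      rw [this, Matrix.trace_mul_comm, ← mul_assoc, U2_conjTranspose_mul]
      simp [pauliBasis, sigmaX, sigmaY, sigmaZ, Matrix.trace_fin_two]
      ring
    rw [conj_pauliBasis, conj_pauliBasis, conj_pauliBasis] at h1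
    have h2 := congrArg Complex.im h1
    simp [Fin.sum_univ_three, pauliBasis, sigmaX, sigmaY, sigmaZ, Matrix.trace_fin_two] at h2
    rw [Matrix.det_fin_three]
    linarith

theorem continuous_adjRot : Continuous adjRot := by
  refine continuous_matrix fun i j => ?_
  unfold adjRot
  simp only [Matrix.of_apply]
  fun_prop

theorem exists_smul_of_adjRot_eq {u v : U2} (h : adjRot u.1 = adjRot v.1) :
    ∃ c : ℂ, u.1 = c • v.1 := by
  have hc : ∀ j, Commute (v.1ᴴ * u.1) (pauliBasis j) := by
    intro j
    have h1 : u.1 * pauliBasis j * u.1ᴴ = v.1 * pauliBasis j * v.1ᴴ := by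
      rw [conj_pauliBasis, conj_pauliBasis, h]
    have h2 := congrArg (fun m => v.1ᴴ * m * u.1) h1
    change v.1ᴴ * u.1 * pauliBasis j = pauliBasis j * (v.1ᴴ * u.1)
    calc v.1ᴴ * u.1 * pauliBasis j = v.1ᴴ * (u.1 * pauliBasis j * u.1ᴴ) * u.1 := by
          simp only [mul_assoc, U2_conjTranspose_mul, mul_one]
      _ = v.1ᴴ * v.1 * (pauliBasis j * (v.1ᴴ * u.1)) := by rw [h1]; simp only [mul_assoc]
      _ = _ := by rw [U2_conjTranspose_mul, one_mul]
  have hs := eq_smul_one_of_commute fun a =>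
    (((hc 2).pow_right a.1.val).mul_right ((hc 0).pow_right a.2.val)).eq
  refine ⟨(v.1ᴴ * u.1) 0 0, ?_⟩
  calc u.1 = v.1 * (v.1ᴴ * u.1) := by rw [← mul_assoc, U2_mul_conjTranspose, one_mul]
    _ = _ := by
      rw [hs]
      simp

/-! ### The quotient group as a compact solvable group -/

instance compactSpace_U2 : CompactSpace U2 := by
  refine isCompact_iff_compactSpace.mp (IsCompact.of_isClosed_subset
    (isCompact_univ_pi fun _ : Fin 2 => isCompact_univ_pi fun _ : Fin 2 =>
      isCompact_closedBall (0 : ℂ) 1) ?_ ?_)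
  · exact isClosed_unitary
  · intro u hu i _ j _
    rw [mem_closedBall_zero_iff]
    exact entry_norm_bound_of_unitary hu i j

theorem continuous_opOf : Continuous (opOf : (P → U2) → MatP P) := by
  refine continuous_matrix fun i j => ?_
  unfold opOf locOp
  simp only [Matrix.of_apply]
  exact continuous_finsetProd _ fun p _ =>
    (continuous_subtype_val.comp (continuous_apply p)).matrix_elem (i p) (j p)

theorem isClosed_code (L : Submodule (ZMod 2) (QV P)) (σ : PauliSection L) :
    IsClosed (code L σ : Set (HP P)) :=
  (code L σ).closed_of_finiteDimensional

theorem isClosed_transversalGroup (L : Submodule (ZMod 2) (QV P)) (σ : PauliSection L) :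
    IsClosed (transversalGroup L σ : Set (P → U2)) := by
  have h : (transversalGroup L σ : Set (P → U2)) =
      ⋂ ψ ∈ code L σ, (fun u => opOf u *ᵥ ψ) ⁻¹' (code L σ : Set (HP P)) := by
    ext u
    simp only [Set.mem_iInter]
    rfl
  rw [h]
  exact isClosed_biInter fun ψ _ =>
    (isClosed_code L σ).preimage (continuous_opOf.matrix_mulVec continuous_const)

instance compactSpace_transversalGroup (L : Submodule (ZMod 2) (QV P)) (σ : PauliSection L) :
    CompactSpace (transversalGroup L σ) :=
  isCompact_iff_compactSpace.mp (isClosed_transversalGroup L σ).isCompact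

theorem exists_opOf_eq_smul {u v : P → U2} (h : ∀ p, adjRot (u p).1 = adjRot (v p).1) :
    ∃ c : ℂ, opOf u = c • opOf v := by
  choose c hc using fun p => exists_smul_of_adjRot_eq (h p)
  refine ⟨∏ p, c p, ?_⟩
  rw [opOf, opOf, ← locOp_smul]
  exact congrArg locOp (funext hc)

variable (L : Submodule (ZMod 2) (QV P)) (σ : PauliSection L)

theorem mem_scalarGroup_of_adjRot_eq {u v : P → U2} (h : ∀ p, adjRot (u p).1 = adjRot (v p).1)
    (hv : v ∈ scalarGroup L σ) : u ∈ scalarGroup L σ := by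
  obtain ⟨c, hc⟩ := exists_opOf_eq_smul h
  obtain ⟨d, hd⟩ := hv
  refine ⟨c * d, fun ψ hψ => ?_⟩
  rw [hc, Matrix.smul_mulVec, hd ψ hψ, smul_smul]

/-- The scalar elements among the transversal ones. -/
def scalarSubgroup : Subgroup (transversalGroup L σ) :=
  (scalarGroup L σ).subgroupOf (transversalGroup L σ)

instance scalarSubgroup_normal : (scalarSubgroup L σ).Normal := by
  refine ⟨fun n hn g => ?_⟩
  obtain ⟨c, hc⟩ := Subgroup.mem_subgroupOf.mp hn
  refine Subgroup.mem_subgroupOf.mpr ⟨c, fun ψ hψ => ?_⟩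
  change opOf (g.1 * n.1 * g.1⁻¹) *ᵥ ψ = _
  rw [opOf_mul, opOf_mul, ← Matrix.mulVec_mulVec, ← Matrix.mulVec_mulVec,
    hc _ (opOf_inv_mulVec_mem g.2 ψ hψ), Matrix.mulVec_smul, Matrix.mulVec_mulVec, opOf_mul_inv,
    Matrix.one_mulVec]

theorem mk_eq_mk_of_adjRot_eq {u v : transversalGroup L σ}
    (h : ∀ p, adjRot (u.1 p).1 = adjRot (v.1 p).1) :
    (QuotientGroup.mk u : transversalGroup L σ ⧸ scalarSubgroup L σ) = QuotientGroup.mk v := by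
  refine QuotientGroup.eq.mpr (Subgroup.mem_subgroupOf.mpr
    (mem_scalarGroup_of_adjRot_eq L σ (v := 1) (fun p => ?_) (scalarGroup L σ).one_mem))
  change adjRot ((u.1 p)⁻¹.1 * (v.1 p).1) = adjRot (1 : U2).1
  rw [adjRot_mul, ← h p, ← adjRot_mul]
  exact congrArg adjRot (U2_conjTranspose_mul (u.1 p))

/-- The family of rotations induced by a transversal unitary. -/
def toAutSet (u : transversalGroup L σ) : autSet L σ :=
  ⟨fun p => adjRot (u.1 p).1, fun p => (u.1 p).1, fun p => (u.1 p).2, fun _ => rfl, u.2⟩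

theorem toAutSet_surjective : Function.Surjective (toAutSet L σ) := by
  rintro ⟨a, u, hu, hua, h⟩
  exact ⟨⟨fun p => ⟨u p, hu p⟩, h⟩, Subtype.ext (funext hua)⟩

theorem continuous_toAutSet : Continuous (toAutSet L σ) := by
  refine Continuous.subtype_mk (continuous_pi fun p => continuous_adjRot.comp ?_) _
  exact continuous_subtype_val.comp ((continuous_apply p).comp continuous_subtype_val)

theorem isQuotientMap_toAutSet : Topology.IsQuotientMap (toAutSet L σ) :=
  (continuous_toAutSet L σ).isClosedMap.isQuotientMap (continuous_toAutSet L σ)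
    (toAutSet_surjective L σ)

/-- The class modulo scalars of a transversal lift of an automorphism of the code. -/
def autClass (a : P → Rot) : transversalGroup L σ ⧸ scalarSubgroup L σ :=
  if h : a ∈ autSet L σ then
    QuotientGroup.mk (Function.surjInv (toAutSet_surjective L σ) ⟨a, h⟩)
  else 1

theorem autClass_toAutSet (u : transversalGroup L σ) :
    autClass L σ (toAutSet L σ u).1 = QuotientGroup.mk u := by
  rw [autClass, dif_pos (toAutSet L σ u).2]
  refine mk_eq_mk_of_adjRot_eq L σ fun p => ?_
  have h := Function.surjInv_eq (toAutSet_surjective L σ) (toAutSet L σ u)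
  exact congrFun (congrArg Subtype.val h) p

theorem continuousOn_autClass : ContinuousOn (autClass L σ) (autSet L σ) := by
  rw [continuousOn_iff_continuous_domRestrict, (isQuotientMap_toAutSet L σ).continuous_iff]
  have h : (autSet L σ).domRestrict (autClass L σ) ∘ toAutSet L σ = QuotientGroup.mk :=
    funext (autClass_toAutSet L σ)
  rw [h]
  exact continuous_quotient_mk'

theorem isSolvable_of_derivedSeries_le_ker {G H : Type} [Group G] [Group H] {f : G →* H}
    (hf : Function.Surjective f) {n : ℕ} (h : derivedSeries G n ≤ f.ker) : Group.IsSolvable H := by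
  refine (Group.isSolvable_def H).mpr ⟨n, ?_⟩
  rwa [← map_derivedSeries_eq hf, Subgroup.map_eq_bot_iff]

theorem nonempty_compactSolvableQuotientStructure {L : Submodule (ZMod 2) (QV P)}
    (hL : Isotropic L) (hzero : ¬ HasZeroFactor L) (σ : PauliSection L) :
    Nonempty (CompactSolvableQuotientStructure (P → Rot) (autSet L σ) (zSet L σ)) := by
  refine ⟨{
    G := transversalGroup L σ ⧸ scalarSubgroup L σ
    cpt := inferInstance
    solv := isSolvable_of_derivedSeries_le_ker (QuotientGroup.mk'_surjective _) (n := 3) ?_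
    φ := autClass L σ
    cont := continuousOn_autClass L σ
    map_mul' := ?_
    surj := fun y => ?_
    ker := ?_ }⟩
  · rw [QuotientGroup.ker_mk']
    exact fun u hu => Subgroup.mem_subgroupOf.mpr (derivedSeries_transversalGroup_le hL hzero σ hu)
  · intro a ha b hb
    obtain ⟨u, hu⟩ := toAutSet_surjective L σ ⟨a, ha⟩
    obtain ⟨v, hv⟩ := toAutSet_surjective L σ ⟨b, hb⟩
    obtain rfl : (toAutSet L σ u).1 = a := congrArg Subtype.val hu
    obtain rfl : (toAutSet L σ v).1 = b := congrArg Subtype.val hv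
    have h : (toAutSet L σ u).1 * (toAutSet L σ v).1 = (toAutSet L σ (u * v)).1 :=
      funext fun p => (adjRot_mul (u.1 p) (v.1 p)).symm
    rw [h, autClass_toAutSet, autClass_toAutSet, autClass_toAutSet]
    rfl
  · obtain ⟨u, rfl⟩ := QuotientGroup.mk_surjective y
    exact ⟨_, (toAutSet L σ u).2, autClass_toAutSet L σ u⟩
  · intro a ha
    obtain ⟨u, hu⟩ := toAutSet_surjective L σ ⟨a, ha⟩
    obtain rfl : (toAutSet L σ u).1 = a := congrArg Subtype.val hu
    rw [autClass_toAutSet, QuotientGroup.eq_one_iff, scalarSubgroup, Subgroup.mem_subgroupOf]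
    constructor
    · exact fun h => ⟨fun p => (u.1 p).1, fun p => (u.1 p).2, fun _ => rfl, h⟩
    · rintro ⟨v, hv, hvu, h⟩
      exact mem_scalarGroup_of_adjRot_eq L σ (v := fun p => ⟨v p, hv p⟩)
        (fun p => (hvu p).symm) h

/-! ### Gates on a logical qubit -/

section Logical

variable {L : Submodule (ZMod 2) (QV P)} {σ : PauliSection L} {d : ℕ}
  (e : ↥(code L σ) ≃ₗ[ℂ] HP (Fin d)) (k : Fin d)

theorem oneQubitOp_mul (w w' : Matrix (Fin 2) (Fin 2) ℂ) :
    oneQubitOp d k (w * w') = oneQubitOp d k w * oneQubitOp d k w' := by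
  rw [oneQubitOp, oneQubitOp, oneQubitOp, ← locOp_mul]
  congr 1
  funext j
  split_ifs <;> simp

theorem oneQubitOp_one : oneQubitOp d k 1 = 1 := by
  rw [oneQubitOp, ← locOp_one]
  congr 1
  funext j
  split_ifs <;> rfl

theorem continuous_oneQubitOp : Continuous (oneQubitOp d k) := by
  refine continuous_matrix fun i j => ?_
  unfold oneQubitOp locOp
  simp only [Matrix.of_apply]
  refine continuous_finsetProd _ fun q _ => ?_
  split_ifs
  · exact continuous_id.matrix_elem _ _
  · exact continuous_const

/-- A one-qubit operator acting by a scalar on the register is itself scalar. -/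
theorem eq_smul_one_of_oneQubitOp_mulVec {w : Matrix (Fin 2) (Fin 2) ℂ} {c : ℂ}
    (h : ∀ φ : HP (Fin d), oneQubitOp d k w *ᵥ φ = c • φ) : w = c • 1 := by
  have hm : oneQubitOp d k w = c • 1 := by
    refine Matrix.toLin'.injective (LinearMap.ext fun φ => ?_)
    rw [Matrix.toLin'_apply, Matrix.toLin'_apply, h, Matrix.smul_mulVec, Matrix.one_mulVec]
  ext a b
  have hab := congrFun (congrFun hm (fun j => if j = k then a else 0))
    (fun j => if j = k then b else 0)
  have hne : (fun j : Fin d => if j = k then a else (0 : Fin 2)) =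
      (fun j => if j = k then b else 0) ↔ a = b :=
    ⟨fun h' => by simpa using congrFun h' k, fun h' => by rw [h']⟩
  rw [Matrix.smul_apply, Matrix.one_apply] at hab ⊢
  simp only [hne] at hab
  rw [← hab, oneQubitOp, locOp, Matrix.of_apply, Finset.prod_eq_single k]
  · simp
  · intro j _ hj
    change (if j = k then w else 1) (if j = k then a else 0) (if j = k then b else 0) = 1
    rw [if_neg hj, if_neg hj, if_neg hj, Matrix.one_apply_eq]
  · simp

/-- Pairs of a one-qubit gate and a transversal gate realising it on the logical qubit `k`. -/
def realisationGroup : Subgroup (U2 × (P → U2)) where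
  carrier := {x | ∀ φ : HP (Fin d), opOf x.2 *ᵥ (e.symm φ : HP P) =
    (e.symm (oneQubitOp d k x.1.1 *ᵥ φ) : HP P)}
  mul_mem' := by
    intro x y hx hy φ
    change opOf (x.2 * y.2) *ᵥ _ = (e.symm (oneQubitOp d k (x.1.1 * y.1.1) *ᵥ φ) : HP P)
    rw [opOf_mul, ← Matrix.mulVec_mulVec, hy φ, hx, Matrix.mulVec_mulVec, oneQubitOp_mul]
  one_mem' := by
    intro φ
    change opOf 1 *ᵥ _ = (e.symm (oneQubitOp d k 1 *ᵥ φ) : HP P)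
    rw [opOf_one, oneQubitOp_one, Matrix.one_mulVec, Matrix.one_mulVec]
  inv_mem' := by
    intro x hx φ
    change opOf x.2⁻¹ *ᵥ _ = (e.symm (oneQubitOp d k x.1.1ᴴ *ᵥ φ) : HP P)
    have h := hx (oneQubitOp d k x.1.1ᴴ *ᵥ φ)
    rw [Matrix.mulVec_mulVec, ← oneQubitOp_mul, U2_mul_conjTranspose, oneQubitOp_one,
      Matrix.one_mulVec] at h
    rw [← h, Matrix.mulVec_mulVec, opOf_inv_mul, Matrix.one_mulVec]

theorem mem_transversalGroup_of_mem_realisationGroup {x : U2 × (P → U2)}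
    (hx : x ∈ realisationGroup e k) : x.2 ∈ transversalGroup L σ := by
  intro ψ hψ
  have h := hx (e ⟨ψ, hψ⟩)
  rw [e.symm_apply_apply] at h
  change opOf x.2 *ᵥ ψ = _ at h
  rw [h]
  exact Subtype.property _

/-- The transversal gate of a realisation. -/
def realisationToTransversal : realisationGroup e k →* transversalGroup L σ :=
  ((MonoidHom.snd U2 (P → U2)).comp (realisationGroup e k).subtype).codRestrict _
    fun x => mem_transversalGroup_of_mem_realisationGroup e k x.2

/-- The rotation of the logical qubit described by a realisation. -/
def realisationToRot : realisationGroup e k →* Rot where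
  toFun x := adjRot x.1.1.1
  map_one' := adjRot_one
  map_mul' x y := adjRot_mul x.1.1 y.1.1

theorem range_realisationToRot : Set.range (realisationToRot e k) = logicalSet L σ e k := by
  ext A
  constructor
  · rintro ⟨x, rfl⟩
    exact ⟨x.1.1.1, x.1.1.2, rfl, fun p => (x.1.2 p).1, fun p => (x.1.2 p).2, x.2⟩
  · rintro ⟨w, hw, rfl, u, hu, h⟩
    exact ⟨⟨⟨⟨w, hw⟩, fun p => ⟨u p, hu p⟩⟩, h⟩, rfl⟩

theorem isClosed_realisationGroup : IsClosed (realisationGroup e k : Set (U2 × (P → U2))) := by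
  have h : (realisationGroup e k : Set (U2 × (P → U2))) = ⋂ φ : HP (Fin d),
      {x | opOf x.2 *ᵥ (e.symm φ : HP P) = (e.symm (oneQubitOp d k x.1.1 *ᵥ φ) : HP P)} := by
    ext x
    simp only [Set.mem_iInter]
    rfl
  rw [h]
  refine isClosed_iInter fun φ => isClosed_eq ?_ ?_
  · exact (continuous_opOf.comp continuous_snd).matrix_mulVec continuous_const
  · refine continuous_subtype_val.comp
      ((LinearMap.continuous_of_finiteDimensional e.symm.toLinearMap).comp ?_)
    exact ((continuous_oneQubitOp k).comp
      (continuous_subtype_val.comp continuous_fst)).matrix_mulVec continuous_const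

theorem isClosed_logicalSet : IsClosed (logicalSet L σ e k) := by
  have := isCompact_iff_compactSpace.mp (isClosed_realisationGroup e k).isCompact
  rw [← range_realisationToRot]
  refine (isCompact_range ?_).isClosed
  exact continuous_adjRot.comp
    (continuous_subtype_val.comp (continuous_fst.comp continuous_subtype_val))

theorem logicalSet_subset_SO3 : logicalSet L σ e k ⊆ SO3 := by
  rintro _ ⟨w, hw, rfl, -⟩
  exact adjRot_mem_SO3 ⟨w, hw⟩

theorem derivedSeries_realisationGroup_le (hL : Isotropic L) (hzero : ¬ HasZeroFactor L)
    {x : realisationGroup e k} (hx : x ∈ derivedSeries (realisationGroup e k) 3) :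
    realisationToRot e k x = 1 := by
  obtain ⟨c, hc⟩ := derivedSeries_transversalGroup_le hL hzero σ
    (map_derivedSeries_le_derivedSeries (f := realisationToTransversal e k) 3
      (Subgroup.mem_map_of_mem _ hx))
  have h : ∀ φ : HP (Fin d), oneQubitOp d k x.1.1.1 *ᵥ φ = c • φ := by
    intro φ
    apply e.symm.injective
    apply Subtype.ext
    rw [map_smul, ← x.2 φ]
    exact hc _ (e.symm φ).2
  have hw := eq_smul_one_of_oneQubitOp_mulVec k h
  have hc1 : ‖c‖ = 1 := by
    have h1 := congrFun (congrFun (U2_mul_conjTranspose x.1.1) 0) 0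
    rw [hw] at h1
    have h2 : (starRingEnd ℂ) c * c = 1 := by simpa using h1
    have h3 := congrArg norm h2
    rw [norm_mul, RCLike.norm_conj, norm_one, ← sq] at h3
    exact (pow_eq_one_iff_of_nonneg (norm_nonneg c) two_ne_zero).mp h3
  change adjRot x.1.1.1 = 1
  rw [hw, adjRot_smul_one hc1]

theorem nonempty_solvableGroupStructure (hL : Isotropic L) (hzero : ¬ HasZeroFactor L) :
    Nonempty (SolvableGroupStructure Rot (logicalSet L σ e k)) := by
  refine ⟨{
    G := (realisationToRot e k).toHomUnits.range
    solv := isSolvable_of_derivedSeries_le_ker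
      (realisationToRot e k).toHomUnits.rangeRestrict_surjective (n := 3) fun x hx => ?_
    f := fun y => (y.1 : Rot)
    inj := fun y z h => Subtype.ext (Units.ext h)
    map_mul := fun _ _ => rfl
    range_eq := ?_ }⟩
  · rw [MonoidHom.ker_rangeRestrict]
    exact Units.ext (derivedSeries_realisationGroup_le e k hL hzero hx)
  · rw [← range_realisationToRot]
    ext A
    constructor
    · rintro ⟨⟨_, x, rfl⟩, rfl⟩
      exact ⟨x, rfl⟩
    · rintro ⟨x, rfl⟩
      exact ⟨⟨_, x, rfl⟩, rfl⟩

end Logical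

/-! ### The rotation group is not solvable -/

theorem rotX_mem_SO3 (θ : ℝ) : rotX θ ∈ SO3 := by
  have h := Real.sin_sq_add_cos_sq θ
  constructor
  · ext i j
    fin_cases i <;> fin_cases j <;> simp [rotX, Matrix.mul_apply, Fin.sum_univ_three] <;>
      linarith
  · rw [rotX, Matrix.det_fin_three]
    simp
    linarith

theorem rotY_mem_SO3 (θ : ℝ) : rotY θ ∈ SO3 := by
  have h := Real.sin_sq_add_cos_sq θ
  constructor
  · ext i j
    fin_cases i <;> fin_cases j <;> simp [rotY, Matrix.mul_apply, Fin.sum_univ_three] <;>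
      linarith
  · rw [rotY, Matrix.det_fin_three]
    simp
    linarith

theorem rotX_mul_rotY_pi (θ : ℝ) :
    rotX (θ / 2) * rotY π = rotX θ * (rotY π * rotX (θ / 2)) := by
  obtain ⟨t, rfl⟩ : ∃ t, θ = 2 * t := ⟨θ / 2, by ring⟩
  have h := Real.sin_sq_add_cos_sq t
  rw [mul_div_cancel_left₀ t two_ne_zero]
  ext i j
  fin_cases i <;> fin_cases j <;>
    simp [rotX, rotY, Matrix.mul_apply, Fin.sum_univ_three, Real.cos_two_mul,
      Real.sin_two_mul] <;> grind

theorem rotY_mul_rotX_pi (θ : ℝ) :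
    rotY (θ / 2) * rotX π = rotY θ * (rotX π * rotY (θ / 2)) := by
  obtain ⟨t, rfl⟩ : ∃ t, θ = 2 * t := ⟨θ / 2, by ring⟩
  have h := Real.sin_sq_add_cos_sq t
  rw [mul_div_cancel_left₀ t two_ne_zero]
  ext i j
  fin_cases i <;> fin_cases j <;>
    simp [rotX, rotY, Matrix.mul_apply, Fin.sum_univ_three, Real.cos_two_mul,
      Real.sin_two_mul] <;> grind

section NotSolvable

open scoped commutatorElement

theorem isEmpty_solvableGroupStructure_SO3 : IsEmpty (SolvableGroupStructure Rot SO3) := by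
  constructor
  rintro ⟨G, hsolv, f, hinj, hmul, hrange⟩
  have hlift : ∀ A ∈ SO3, ∃ x, f x = A := fun A hA => by rwa [← hrange] at hA
  choose x hx using fun θ => hlift _ (rotX_mem_SO3 θ)
  choose y hy using fun θ => hlift _ (rotY_mem_SO3 θ)
  have hxc : ∀ θ, x θ = ⁅x (θ / 2), y π⁆ := by
    intro θ
    rw [commutatorElement_def, eq_mul_inv_iff_mul_eq, eq_mul_inv_iff_mul_eq, mul_assoc]
    apply hinj
    simp only [hmul, hx, hy, rotX_mul_rotY_pi]
  have hyc : ∀ θ, y θ = ⁅y (θ / 2), x π⁆ := by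
    intro θ
    rw [commutatorElement_def, eq_mul_inv_iff_mul_eq, eq_mul_inv_iff_mul_eq, mul_assoc]
    apply hinj
    simp only [hmul, hx, hy, rotY_mul_rotX_pi]
  have hmem : ∀ n, (∀ θ, x θ ∈ derivedSeries G n) ∧ ∀ θ, y θ ∈ derivedSeries G n := by
    intro n
    induction n with
    | zero => exact ⟨fun _ => Subgroup.mem_top _, fun _ => Subgroup.mem_top _⟩
    | succ n ih =>
      refine ⟨fun θ => ?_, fun θ => ?_⟩
      · rw [hxc]
        exact Subgroup.commutator_mem_commutator (ih.1 _) (ih.2 _)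
      · rw [hyc]
        exact Subgroup.commutator_mem_commutator (ih.2 _) (ih.1 _)
  obtain ⟨n, hn⟩ := (Group.isSolvable_def G).mp hsolv
  have h1 : ∀ θ, x θ = 1 := fun θ => by
    rw [← Subgroup.mem_bot, ← hn]
    exact (hmem n).1 θ
  have h2 : rotX π = rotX 0 := by rw [← hx, ← hx, h1, h1]
  have h3 := congrFun (congrFun h2 1) 1
  norm_num [rotX] at h3

end NotSolvable

/-- **Corollary (no universal transversal gates).** Let `L ⊆ V^P` be an isotropic
subspace that does not split off a zero factor. Then `Ā(L) = A(L)/Z(L)` is a solvable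
compact (Lie) group. Consequently, for any unitary identification of the code with a
space of `d` logical qubits and any fixed logical qubit, the subgroup of `SO(3)`
induced transversally is a solvable, closed, hence proper, subgroup of `SO(3)`, and the
same remains true for the one-qubit operators admitting only approximate transversal
realisations. -/
theorem no_universal_transversal {P : Type} [Fintype P] [DecidableEq P]
    (L : Submodule (ZMod 2) (QV P)) (hL : Isotropic L)
    (hzero : ¬ HasZeroFactor L) (σ : PauliSection L) :
    Nonempty (CompactSolvableQuotientStructure (P → Rot) (autSet L σ) (zSet L σ)) ∧
    ∀ (d : ℕ) (e : ↥(code L σ) ≃ₗ[ℂ] HP (Fin d)), IsUnitaryEquiv L σ e →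
      ∀ k : Fin d,
        logicalSet L σ e k ⊆ SO3 ∧
        IsClosed (logicalSet L σ e k) ∧
        Nonempty (SolvableGroupStructure Rot (logicalSet L σ e k)) ∧
        logicalSet L σ e k ≠ SO3 ∧
        Nonempty (SolvableGroupStructure Rot (closure (logicalSet L σ e k))) ∧
        closure (logicalSet L σ e k) ≠ SO3 := by
  refine ⟨nonempty_compactSolvableQuotientStructure hL hzero σ, fun d e _ k => ?_⟩
  have hsolv := nonempty_solvableGroupStructure e k hL hzero
  have hne : logicalSet L σ e k ≠ SO3 := by
    intro h
    rw [h] at hsolv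
    exact isEmpty_solvableGroupStructure_SO3.elim hsolv.some
  have hclosed := isClosed_logicalSet e k
  rw [hclosed.closure_eq]
  exact ⟨logicalSet_subset_SO3 e k, hclosed, hsolv, hne, hsolv, hne⟩

end Stab
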